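/- arXiv:1802.07561 — 2 statements merged into one kernel-verified Lean document; each statement's English description precedes it below -/
import Mathlib

section
/- Let n ≥ 3. If Z : P_o^n → K_o^n is an SL(n) covariant L_∞ Minkowski valuation, then h_{Z(sT^d)}(e₁) = s·h_{Z(T^d)}(e₁) and h_{Z(sT^d)}(−e₁) = s·h_{Z(T^d)}(−e₁) for every 1 ≤ d ≤ n and every s > 0; moreover h_{Z(T^1)}(e₁) ≤ h_{Z(T^2)}(e₁) ≤ … ≤ h_{Z(T^n)}(e₁) and h_{Z(T^1)}(−e₁) ≤ h_{Z(T^2)}(−e₁) ≤ … ≤ h_{Z(T^n)}(−e₁). -/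
open scoped RealInnerProductSpace BigOperators Pointwise ENNReal
open MeasureTheory Filter Matrix

noncomputable section

/-- `Euc n` is Euclidean space `ℝ^n`. -/
abbrev Euc (n : ℕ) := EuclideanSpace ℝ (Fin n)

/-- A convex body in `ℝ^n` containing the origin: a nonempty compact convex set with `0 ∈ K`. -/
def IsConvexBody0 {n : ℕ} (K : Set (Euc n)) : Prop :=
  IsCompact K ∧ Convex ℝ K ∧ (0 : Euc n) ∈ K

/-- A convex polytope in `ℝ^n` containing the origin. -/
def IsPolytope0 {n : ℕ} (P : Set (Euc n)) : Prop :=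
  (∃ S : Finset (Euc n), P = convexHull ℝ (S : Set (Euc n))) ∧ (0 : Euc n) ∈ P

/-- The support function `h_K(x) = sup { ⟪x, y⟫ : y ∈ K }`. -/
def supp {n : ℕ} (K : Set (Euc n)) (x : Euc n) : ℝ :=
  sSup ((fun y => ⟪x, y⟫) '' K)

/-- The image of a set under the linear map induced by a matrix. -/
def matAct {n : ℕ} (A : Matrix (Fin n) (Fin n) ℝ) (K : Set (Euc n)) : Set (Euc n) :=
  (Matrix.toEuclideanLin A) '' K

/-- The vector `A x`. -/
def matVec {n : ℕ} (A : Matrix (Fin n) (Fin n) ℝ) (x : Euc n) : Euc n :=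
  Matrix.toEuclideanLin A x

/-- The dimension of a set: the dimension of (the direction of) its affine hull. -/
def sdim {n : ℕ} (P : Set (Euc n)) : ℕ :=
  Module.finrank ℝ (affineSpan ℝ P).direction

/-- `Z` is `SL(n)` covariant on polytopes containing the origin. -/
def SLCovariant {n : ℕ} (Z : Set (Euc n) → Set (Euc n)) : Prop :=
  ∀ (φ : Matrix.SpecialLinearGroup (Fin n) ℝ) (P : Set (Euc n)), IsPolytope0 P →
    Z (matAct (φ : Matrix (Fin n) (Fin n) ℝ) P) = matAct (φ : Matrix (Fin n) (Fin n) ℝ) (Z P)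

/-- `Z` is an `L_∞` Minkowski valuation on polytopes containing the origin:
`Z(K ∪ L) +_∞ Z(K ∩ L) = Z K +_∞ Z L`, where `A +_∞ B = convexHull (A ∪ B)`. -/
def ValuationInf {n : ℕ} (Z : Set (Euc n) → Set (Euc n)) : Prop :=
  ∀ K L : Set (Euc n), IsPolytope0 K → IsPolytope0 L → IsPolytope0 (K ∪ L) →
    IsPolytope0 (K ∩ L) →
    convexHull ℝ (Z (K ∪ L) ∪ Z (K ∩ L)) = convexHull ℝ (Z K ∪ Z L)

/-- The `i`-th standard basis vector. -/
def bvec {n : ℕ} (i : Fin n) : Euc n := EuclideanSpace.single i (1 : ℝ)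

/-- The simplex `T^d = [o, e₁, …, e_d]` inside `ℝ^n`. -/
def Td (n d : ℕ) : Set (Euc n) :=
  convexHull ℝ (insert 0 (bvec '' {i : Fin n | (i : ℕ) < d}))

section SupportFunction

variable {n : ℕ}

lemma IsConvexBody0.bddAbove_image_inner {K : Set (Euc n)} (hK : IsConvexBody0 K) (x : Euc n) :
    BddAbove ((fun y => ⟪x, y⟫) '' K) :=
  (hK.1.image (by fun_prop)).bddAbove

lemma supp_nonneg {K : Set (Euc n)} (hK : IsConvexBody0 K) (x : Euc n) : 0 ≤ supp K x :=
  le_csSup (hK.bddAbove_image_inner x) ⟨0, hK.2.2, by simp⟩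

lemma inner_le_supp {K : Set (Euc n)} (hK : IsConvexBody0 K) (x : Euc n) {y : Euc n}
    (hy : y ∈ K) : ⟪x, y⟫ ≤ supp K x :=
  le_csSup (hK.bddAbove_image_inner x) ⟨y, hy, rfl⟩

lemma supp_add_le {K : Set (Euc n)} (hK : IsConvexBody0 K) (x y : Euc n) :
    supp K (x + y) ≤ supp K x + supp K y := by
  refine csSup_le (Set.Nonempty.image _ ⟨0, hK.2.2⟩) ?_
  rintro _ ⟨z, hz, rfl⟩
  simp only [inner_add_left]
  exact add_le_add (inner_le_supp hK x hz) (inner_le_supp hK y hz)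

lemma supp_smul (K : Set (Euc n)) {c : ℝ} (hc : 0 ≤ c) (x : Euc n) :
    supp K (c • x) = c * supp K x := by
  unfold supp
  rw [← smul_eq_mul, ← Real.sSup_smul_of_nonneg hc, ← Set.image_smul, Set.image_image]
  simp [real_inner_smul_left]

lemma supp_neg (K : Set (Euc n)) (x : Euc n) : supp (-K) x = supp K (-x) := by
  unfold supp
  rw [← Set.image_neg_eq_neg, Set.image_image]
  simp

lemma supp_convexHull_union {K L : Set (Euc n)} (hK : IsConvexBody0 K) (hL : IsConvexBody0 L)
    (x : Euc n) : supp (convexHull ℝ (K ∪ L)) x = max (supp K x) (supp L x) := by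
  have hle : ∀ y ∈ convexHull ℝ (K ∪ L), ⟪x, y⟫ ≤ max (supp K x) (supp L x) := by
    have hsub : convexHull ℝ (K ∪ L) ⊆ {y | ⟪x, y⟫ ≤ max (supp K x) (supp L x)} := by
      refine convexHull_min ?_ (convex_halfSpace_le (innerSL ℝ x).toLinearMap.isLinear _)
      rintro y (hy | hy)
      · exact (inner_le_supp hK x hy).trans (le_max_left _ _)
      · exact (inner_le_supp hL x hy).trans (le_max_right _ _)
    exact hsub
  have hbdd : BddAbove ((fun y => ⟪x, y⟫) '' convexHull ℝ (K ∪ L)) :=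
    ⟨_, by rintro _ ⟨y, hy, rfl⟩; exact hle y hy⟩
  refine le_antisymm ?_ (max_le ?_ ?_)
  · refine csSup_le (Set.Nonempty.image _ ⟨0, subset_convexHull ℝ _ (Or.inl hK.2.2)⟩) ?_
    rintro _ ⟨y, hy, rfl⟩
    exact hle y hy
  · exact csSup_le_csSup hbdd (Set.Nonempty.image _ ⟨0, hK.2.2⟩)
      (Set.image_mono (Set.subset_union_left.trans (subset_convexHull ℝ _)))
  · exact csSup_le_csSup hbdd (Set.Nonempty.image _ ⟨0, hL.2.2⟩)
      (Set.image_mono (Set.subset_union_right.trans (subset_convexHull ℝ _)))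

lemma inner_toEuclideanLin (M : Matrix (Fin n) (Fin n) ℝ) (x y : Euc n) :
    ⟪x, M.toEuclideanLin y⟫ = ⟪Mᵀ.toEuclideanLin x, y⟫ := by
  simp only [EuclideanSpace.inner_eq_star_dotProduct, Matrix.ofLp_toLpLin, Matrix.toLin'_apply,
    star_trivial]
  rw [Matrix.mulVec_transpose, dotProduct_comm, Matrix.dotProduct_mulVec, dotProduct_comm]

lemma supp_matAct (M : Matrix (Fin n) (Fin n) ℝ) (K : Set (Euc n)) (x : Euc n) :
    supp (matAct M K) x = supp K (Mᵀ.toEuclideanLin x) := by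
  unfold supp matAct
  simp only [Set.image_image, inner_toEuclideanLin]

lemma IsPolytope0.matAct {P : Set (Euc n)} (hP : IsPolytope0 P)
    (M : Matrix (Fin n) (Fin n) ℝ) : IsPolytope0 (matAct M P) := by
  classical
  obtain ⟨⟨S, rfl⟩, h0⟩ := hP
  refine ⟨⟨S.image M.toEuclideanLin, ?_⟩, 0, h0, map_zero _⟩
  rw [Finset.coe_image, ← LinearMap.image_convexHull]
  rfl

lemma isPolytope0_smul_Td (d : ℕ) (s : ℝ) : IsPolytope0 (s • Td n d) := by
  have hfin : (s • insert (0 : Euc n) (bvec '' {i : Fin n | (i : ℕ) < d})).Finite :=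
    (((Set.toFinite _).image _).insert 0).smul_set
  refine ⟨⟨hfin.toFinset, ?_⟩, 0, subset_convexHull ℝ _ (Set.mem_insert _ _), smul_zero s⟩
  rw [hfin.coe_toFinset, convexHull_smul, Td]

lemma mem_Td {d : ℕ} {x : Euc n} :
    x ∈ Td n d ↔ (∀ l, 0 ≤ x l) ∧ (∀ l : Fin n, d ≤ l → x l = 0) ∧ ∑ l, x l ≤ 1 := by
  constructor
  · have hconv : Convex ℝ {x : Euc n |
        (∀ l, 0 ≤ x l) ∧ (∀ l : Fin n, d ≤ l → x l = 0) ∧ ∑ l, x l ≤ 1} := by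
      rintro x ⟨hx₁, hx₂, hx₃⟩ y ⟨hy₁, hy₂, hy₃⟩ a b ha hb hab
      refine ⟨fun l => ?_, fun l hl => ?_, ?_⟩
      · simpa using add_nonneg (mul_nonneg ha (hx₁ l)) (mul_nonneg hb (hy₁ l))
      · simp [hx₂ l hl, hy₂ l hl]
      · simp only [PiLp.add_apply, PiLp.smul_apply, smul_eq_mul, Finset.sum_add_distrib,
          ← Finset.mul_sum]
        nlinarith
    refine fun hx => convexHull_min ?_ hconv hx
    rintro _ (rfl | ⟨i, hi, rfl⟩)
    · simp
    · refine ⟨fun l => ?_, fun l hl => ?_, ?_⟩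
      · simp only [bvec, PiLp.single_apply]
        split_ifs <;> norm_num
      · have : l ≠ i := by rintro rfl; exact absurd hi (by simpa using hl)
        simp [bvec, this]
      · simp [bvec]
  · rintro ⟨h₀, h₁, h₂⟩
    let z : Option (Fin n) → Euc n := fun o => o.elim 0 fun l => if (l : ℕ) < d then bvec l else 0
    let w : Option (Fin n) → ℝ := fun o => o.elim (1 - ∑ l, x l) fun l => x l
    have hz : ∑ o, w o • z o ∈ Td n d := by
      refine (convex_convexHull ℝ _).sum_mem ?_ ?_ ?_
      · rintro (_ | l) -
        · simpa [w] using h₂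
        · exact h₀ l
      · simp [w, Fintype.sum_option]
      · rintro (_ | l) -
        · exact subset_convexHull ℝ _ (Set.mem_insert _ _)
        · refine subset_convexHull ℝ _ ?_
          by_cases hl : (l : ℕ) < d
          · simp only [z, Option.elim, hl, if_true]
            exact Or.inr ⟨l, hl, rfl⟩
          · simp [z, hl]
    convert hz
    ext k
    simp only [Fintype.sum_option, w, z, Option.elim, smul_zero, zero_add, WithLp.ofLp_sum,
      Finset.sum_apply, PiLp.smul_apply, smul_eq_mul]
    rw [Finset.sum_eq_single k]
    · by_cases hk : (k : ℕ) < d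
      · simp [hk, bvec]
      · simp [h₁ k (not_lt.1 hk)]
    · intro l _ hl
      split_ifs <;> simp [bvec, hl.symm]
    · simp

lemma mem_smul_Td {d : ℕ} {s : ℝ} (hs : 0 < s) {x : Euc n} :
    x ∈ s • Td n d ↔ (∀ l, 0 ≤ x l) ∧ (∀ l : Fin n, d ≤ l → x l = 0) ∧ ∑ l, x l ≤ s := by
  rw [Set.mem_smul_set_iff_inv_smul_mem₀ hs.ne', mem_Td]
  simp only [PiLp.smul_apply, smul_eq_mul, ← Finset.mul_sum, mul_eq_zero, inv_eq_zero, hs.ne',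
    false_or]
  refine and_congr (forall_congr' fun l => mul_nonneg_iff_of_pos_left (inv_pos.2 hs))
    (and_congr_right fun _ => ?_)
  rw [inv_mul_le_iff₀ hs, mul_one]

lemma SLCovariant.supp_eq {Z : Set (Euc n) → Set (Euc n)} (hcov : SLCovariant Z)
    {M : Matrix (Fin n) (Fin n) ℝ} (hM : M.det = 1) {P : Set (Euc n)} (hP : IsPolytope0 P)
    (x : Euc n) : supp (Z (matAct M P)) x = supp (Z P) (Mᵀ.toEuclideanLin x) := by
  rw [← supp_matAct, ← hcov ⟨M, hM⟩ P hP]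

lemma IsConvexBody0.neg {K : Set (Euc n)} (hK : IsConvexBody0 K) : IsConvexBody0 (-K) :=
  ⟨hK.1.neg, hK.2.1.neg, by simpa using hK.2.2⟩

lemma SLCovariant.neg {Z : Set (Euc n) → Set (Euc n)} (hcov : SLCovariant Z) :
    SLCovariant fun P => -Z P := by
  intro φ P hP
  simp only [hcov φ P hP]
  simp only [matAct, ← Set.image_neg_eq_neg, Set.image_image, map_neg]

lemma ValuationInf.neg {Z : Set (Euc n) → Set (Euc n)} (hval : ValuationInf Z) :
    ValuationInf fun P => -Z P := by
  intro K L hK hL hU hI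
  simp only [← Set.union_neg, convexHull_neg, hval K L hK hL hU hI]

end SupportFunction

section Shear

variable {n : ℕ}

/-- The linear map that first scales the coordinates by `v` and then adds `c` times the `j`-th
coordinate to the `i`-th one. -/
def scaledShear (i j : Fin n) (c : ℝ) (v : Fin n → ℝ) : Matrix (Fin n) (Fin n) ℝ :=
  transvection i j c * diagonal v

lemma det_scaledShear {i j : Fin n} (hij : i ≠ j) (c : ℝ) (v : Fin n → ℝ) :
    (scaledShear i j c v).det = ∏ l, v l := by
  simp [scaledShear, det_transvection_of_ne i j hij]

lemma scaledShear_apply (i j : Fin n) (c : ℝ) (v : Fin n → ℝ) (y : Euc n) (l : Fin n) :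
    (scaledShear i j c v).toEuclideanLin y l
      = v l * y l + if l = i then c * (v j * y j) else 0 := by
  simp only [scaledShear, transvection, Matrix.ofLp_toLpLin, Matrix.toLin'_apply, ← mulVec_mulVec,
    add_mulVec, one_mulVec, Pi.add_apply, mulVec_diagonal]
  congr 1
  by_cases h : l = i
  · subst h; rw [Matrix.single_mulVec]; simp [mulVec_diagonal]
  · rw [Matrix.single_mulVec]; simp [h]

lemma scaledShear_transpose_apply (i j : Fin n) (c : ℝ) (v : Fin n → ℝ) (x : Euc n) (l : Fin n) :
    (scaledShear i j c v)ᵀ.toEuclideanLin x l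
      = v l * (x l + if l = j then c * x i else 0) := by
  simp only [scaledShear, transvection, Matrix.ofLp_toLpLin, Matrix.toLin'_apply, transpose_mul,
    transpose_add, transpose_one, diagonal_transpose, transpose_single, ← mulVec_mulVec,
    add_mulVec, one_mulVec, Pi.add_apply, mulVec_diagonal]
  congr 2
  by_cases h : l = j
  · subst h; simp [Matrix.single_mulVec]
  · simp [Matrix.single_mulVec, h]

end Shear

section Dissection

variable {n : ℕ}

lemma scaledShear_mem_smul_Td {i j : Fin n} (hij : i ≠ j) {d : ℕ} (hi : (i : ℕ) < d)
    (hj : (j : ℕ) < d) {α β r s : ℝ} (hα : 0 < α) (hβ : 0 < β) (hαβ : α + β = 1) (hr : 0 < r)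
    (hs : 0 < s) {v : Fin n → ℝ} (hv : ∀ l : Fin n, (l : ℕ) < d → l ≠ j → r * v l = s)
    (hvj : r * v j = β * s) {y : Euc n} (hy : y ∈ r • Td n d) :
    (scaledShear i j (α / β) v).toEuclideanLin y ∈ s • Td n d ∧
      r * (β * (scaledShear i j (α / β) v).toEuclideanLin y i
        - α * (scaledShear i j (α / β) v).toEuclideanLin y j) = s * β * y i := by
  obtain ⟨hy₀, hy₁, hy₂⟩ := (mem_smul_Td hr).1 hy
  have key : ∀ l, r * (scaledShear i j (α / β) v).toEuclideanLin y l
      = s * (y l + (if l = i then α * y j else 0) - (if l = j then α * y j else 0)) := by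
    intro l
    rw [scaledShear_apply]
    by_cases hli : l = i
    · subst hli
      simp only [if_true, hij, if_false, sub_zero]
      have h1 : r * (α / β * (v j * y j)) = s * (α * y j) := by
        have : r * (α / β * (v j * y j)) = α / β * (r * v j) * y j := by ring
        rw [this, hvj]; field_simp
      linear_combination y l * hv l hi hij + h1
    · by_cases hlj : l = j
      · subst hlj
        simp only [hli, if_false, if_true]
        linear_combination y l * hvj + s * y l * hαβ
      · simp only [hli, hlj, if_false]
        by_cases hld : (l : ℕ) < d
        · linear_combination y l * hv l hld hlj
        · simp [hy₁ l (not_lt.1 hld)]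
  set x := (scaledShear i j (α / β) v).toEuclideanLin y
  have hxi : r * x i = s * (y i + α * y j) := by simpa [hij] using key i
  have hxj : r * x j = s * (β * y j) := by
    have := key j
    simp only [hij.symm, if_false, if_true] at this
    linear_combination this - s * y j * hαβ
  refine ⟨(mem_smul_Td hs).2 ⟨fun l => ?_, fun l hl => ?_, ?_⟩, ?_⟩
  · refine (mul_nonneg_iff_of_pos_left hr).1 ?_
    by_cases hlj : l = j
    · rw [hlj, hxj]
      exact mul_nonneg hs.le (mul_nonneg hβ.le (hy₀ j))
    · rw [key l]
      simp only [hlj, if_false, sub_zero]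
      refine mul_nonneg hs.le (add_nonneg (hy₀ l) ?_)
      split_ifs
      · exact mul_nonneg hα.le (hy₀ j)
      · exact le_rfl
  · have h1 : l ≠ i := by rintro rfl; omega
    have h2 : l ≠ j := by rintro rfl; omega
    have := key l
    simp only [h1, h2, if_false, hy₁ l hl] at this
    simpa [hr.ne'] using this
  · have : r * ∑ l, x l = s * ∑ l, y l := by
      rw [Finset.mul_sum, Finset.sum_congr rfl fun l _ => key l, ← Finset.mul_sum]
      simp [Finset.sum_add_distrib, Finset.sum_sub_distrib]
    have h2 : r * ∑ l, x l ≤ r * s := by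
      rw [this, mul_comm r s]
      exact mul_le_mul_of_nonneg_left hy₂ hs.le
    exact le_of_mul_le_mul_left h2 hr
  · linear_combination β * hxi - α * hxj

lemma exists_scaledShear_eq {i j : Fin n} (hij : i ≠ j) {d : ℕ} (hi : (i : ℕ) < d)
    (hj : (j : ℕ) < d) {α β r s : ℝ} (hα : 0 < α) (hβ : 0 < β) (hαβ : α + β = 1) (hr : 0 < r)
    (hs : 0 < s) {v : Fin n → ℝ} (hv : ∀ l : Fin n, (l : ℕ) < d → l ≠ j → r * v l = s)
    (hvj : r * v j = β * s) {x : Euc n} (hx : x ∈ s • Td n d) (hle : α * x j ≤ β * x i) :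
    ∃ y ∈ r • Td n d, (scaledShear i j (α / β) v).toEuclideanLin y = x := by
  obtain ⟨hx₀, hx₁, hx₂⟩ := (mem_smul_Td hs).1 hx
  let t := α / β * x j
  have ht : β * t = α * x j := by simp only [t]; field_simp
  have ht0 : 0 ≤ t := mul_nonneg (div_pos hα hβ).le (hx₀ j)
  have hti : t ≤ x i := le_of_mul_le_mul_left (ht.trans_le hle) hβ
  let y : Euc n := WithLp.toLp 2 fun l =>
    r / s * (x l + (if l = j then t else 0) - (if l = i then t else 0))
  have hyl : ∀ l, y l = r / s * (x l + (if l = j then t else 0) - (if l = i then t else 0)) :=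
    fun l => rfl
  have hrs : 0 < r / s := div_pos hr hs
  have hv' : ∀ l : Fin n, (l : ℕ) < d → l ≠ j → v l * (r / s) = 1 := by
    intro l h1 h2
    have := hv l h1 h2
    field_simp
    linarith
  have hvj' : v j * (r / s) = β := by
    field_simp
    linarith
  have hyj : v j * y j = α * x j + β * x j := by
    rw [hyl]
    simp only [hij.symm, if_true, if_false]
    linear_combination (x j + t) * hvj' + ht
  refine ⟨y, (mem_smul_Td hr).2 ⟨fun l => ?_, fun l hl => ?_, ?_⟩, ?_⟩
  · rw [hyl]
    refine mul_nonneg hrs.le ?_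
    by_cases hli : l = i
    · subst hli
      simp only [hij, if_true, if_false]
      linarith
    · simp only [hli, if_false, sub_zero]
      refine add_nonneg (hx₀ l) ?_
      split_ifs
      · exact ht0
      · exact le_rfl
  · have h1 : l ≠ i := by rintro rfl; omega
    have h2 : l ≠ j := by rintro rfl; omega
    simp [hyl, h1, h2, hx₁ l hl]
  · simp only [hyl, ← Finset.mul_sum]
    simp only [Finset.sum_add_distrib, Finset.sum_sub_distrib, Finset.sum_ite_eq',
      Finset.mem_univ, if_true, add_sub_cancel_right]
    rw [div_mul_eq_mul_div, div_le_iff₀ hs]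
    exact mul_le_mul_of_nonneg_left hx₂ hr.le
  · ext l
    rw [scaledShear_apply, hyj]
    by_cases hli : l = i
    · subst hli
      rw [hyl]
      simp only [hij, if_true, if_false]
      have : α / β * (α * x j + β * x j) = t := by
        rw [← add_mul, hαβ, one_mul]
      rw [this]
      linear_combination (x l - t) * hv' l hi hij
    · by_cases hlj : l = j
      · subst hlj
        simp only [hyj, hli, if_false]
        linear_combination x l * hαβ
      · simp only [hyl, hli, hlj, if_false]
        by_cases hld : (l : ℕ) < d
        · linear_combination x l * hv' l hld hlj
        · simp [hx₁ l (not_lt.1 hld)]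

lemma matAct_scaledShear_smul_Td {i j : Fin n} (hij : i ≠ j) {d : ℕ} (hi : (i : ℕ) < d)
    (hj : (j : ℕ) < d) {α β r s : ℝ} (hα : 0 < α) (hβ : 0 < β) (hαβ : α + β = 1) (hr : 0 < r)
    (hs : 0 < s) {v : Fin n → ℝ} (hv : ∀ l : Fin n, (l : ℕ) < d → l ≠ j → r * v l = s)
    (hvj : r * v j = β * s) :
    matAct (scaledShear i j (α / β) v) (r • Td n d)
      = {x | x ∈ s • Td n d ∧ α * x j ≤ β * x i} := by
  ext x
  constructor
  · rintro ⟨y, hy, rfl⟩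
    obtain ⟨h1, h2⟩ := scaledShear_mem_smul_Td hij hi hj hα hβ hαβ hr hs hv hvj hy
    refine ⟨h1, ?_⟩
    have h3 : 0 ≤ s * β * y i := mul_nonneg (mul_pos hs hβ).le (((mem_smul_Td hr).1 hy).1 i)
    rw [← h2] at h3
    linarith [(mul_nonneg_iff_of_pos_left hr).1 h3]
  · rintro ⟨hx, hle⟩
    exact exists_scaledShear_eq hij hi hj hα hβ hαβ hr hs hv hvj hx hle

lemma mem_smul_Td_iff_succ {j : Fin n} {r : ℝ} (hr : 0 < r) {y : Euc n} :
    y ∈ r • Td n j ↔ y ∈ r • Td n (j + 1) ∧ y j = 0 := by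
  rw [mem_smul_Td hr, mem_smul_Td hr]
  constructor
  · rintro ⟨h0, h1, h2⟩
    exact ⟨⟨h0, fun l hl => h1 l (by omega), h2⟩, h1 j le_rfl⟩
  · rintro ⟨⟨h0, h1, h2⟩, h3⟩
    refine ⟨h0, fun l hl => ?_, h2⟩
    rcases hl.eq_or_lt with h | h
    · rwa [← Fin.ext h]
    · exact h1 l h

lemma matAct_scaledShear_smul_Td_facet {i j : Fin n} (hij : i < j) {α β r s : ℝ} (hα : 0 < α)
    (hβ : 0 < β) (hαβ : β + α = 1) (hr : 0 < r) (hs : 0 < s) {v : Fin n → ℝ}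
    (hv : ∀ l : Fin n, (l : ℕ) < (j : ℕ) + 1 → l ≠ i → r * v l = s) (hvi : r * v i = α * s) :
    matAct (scaledShear j i (β / α) v) (r • Td n j)
      = {x | x ∈ s • Td n (j + 1) ∧ β * x i = α * x j} := by
  have hij' : (i : ℕ) < j := hij
  ext x
  constructor
  · rintro ⟨y, hy, rfl⟩
    obtain ⟨hy, hyj⟩ := (mem_smul_Td_iff_succ hr).1 hy
    obtain ⟨h1, h2⟩ :=
      scaledShear_mem_smul_Td hij.ne' (by omega) (by omega) hβ hα hαβ hr hs hv hvi hy
    refine ⟨h1, ?_⟩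
    rw [hyj, mul_zero, mul_eq_zero, or_iff_right hr.ne'] at h2
    linarith
  · rintro ⟨hx, heq⟩
    obtain ⟨y, hy, rfl⟩ := exists_scaledShear_eq hij.ne' (by omega) (by omega) hβ hα hαβ hr hs
      hv hvi hx heq.le
    have h2 := (scaledShear_mem_smul_Td hij.ne' (by omega) (by omega) hβ hα hαβ hr hs hv hvi hy).2
    refine ⟨y, (mem_smul_Td_iff_succ hr).2 ⟨hy, ?_⟩, rfl⟩
    rw [heq, sub_self, mul_zero] at h2
    simpa [hs.ne', hα.ne'] using h2.symm

/-- The valuation property for the dissection of `s T^{j+1}` by the hyperplane through the origin,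
the point `α eᵢ + β eⱼ` and the remaining basis vectors. -/
lemma supp_dissection {Z : Set (Euc n) → Set (Euc n)}
    (hbody : ∀ P : Set (Euc n), IsPolytope0 P → IsConvexBody0 (Z P))
    (hval : ValuationInf Z) (hcov : SLCovariant Z) {i j : Fin n} (hij : i < j)
    {α β r₁ r₂ s : ℝ} (hα : 0 < α) (hβ : 0 < β) (hαβ : α + β = 1) (hr₁ : 0 < r₁) (hr₂ : 0 < r₂)
    (hs : 0 < s) {v₁ v₂ : Fin n → ℝ}
    (hv₁ : ∀ l : Fin n, (l : ℕ) < (j : ℕ) + 1 → l ≠ j → r₁ * v₁ l = s)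
    (hv₁j : r₁ * v₁ j = β * s)
    (hv₂ : ∀ l : Fin n, (l : ℕ) < (j : ℕ) + 1 → l ≠ i → r₂ * v₂ l = s)
    (hv₂i : r₂ * v₂ i = α * s) (hp₁ : ∏ l, v₁ l = 1) (hp₂ : ∏ l, v₂ l = 1) (x : Euc n) :
    max (supp (Z (s • Td n (j + 1))) x)
        (supp (Z (r₂ • Td n j)) ((scaledShear j i (β / α) v₂)ᵀ.toEuclideanLin x))
      = max (supp (Z (r₁ • Td n (j + 1))) ((scaledShear i j (α / β) v₁)ᵀ.toEuclideanLin x))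
        (supp (Z (r₂ • Td n (j + 1))) ((scaledShear j i (β / α) v₂)ᵀ.toEuclideanLin x)) := by
  have hij' : (i : ℕ) < j := hij
  have hβα : β + α = 1 := by linarith
  have hd₁ := (det_scaledShear hij.ne (α / β) v₁).trans hp₁
  have hd₂ := (det_scaledShear hij.ne' (β / α) v₂).trans hp₂
  rw [← hcov.supp_eq hd₂ (isPolytope0_smul_Td _ _), ← hcov.supp_eq hd₂ (isPolytope0_smul_Td _ _),
    ← hcov.supp_eq hd₁ (isPolytope0_smul_Td _ _)]
  have hK := (isPolytope0_smul_Td (n := n) (j + 1) r₁).matAct (scaledShear i j (α / β) v₁)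
  have hL := (isPolytope0_smul_Td (n := n) (j + 1) r₂).matAct (scaledShear j i (β / α) v₂)
  have hI := (isPolytope0_smul_Td (n := n) j r₂).matAct (scaledShear j i (β / α) v₂)
  have hU := isPolytope0_smul_Td (n := n) (j + 1) s
  have hunion : matAct (scaledShear i j (α / β) v₁) (r₁ • Td n (j + 1))
      ∪ matAct (scaledShear j i (β / α) v₂) (r₂ • Td n (j + 1)) = s • Td n (j + 1) := by
    rw [matAct_scaledShear_smul_Td hij.ne (by omega) (by omega) hα hβ hαβ hr₁ hs hv₁ hv₁j,
      matAct_scaledShear_smul_Td hij.ne' (by omega) (by omega) hβ hα hβα hr₂ hs hv₂ hv₂i]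
    ext y
    simp only [Set.mem_union, Set.mem_ofPred_eq, ← and_or_left]
    exact and_iff_left (le_total _ _)
  have hinter : matAct (scaledShear i j (α / β) v₁) (r₁ • Td n (j + 1))
      ∩ matAct (scaledShear j i (β / α) v₂) (r₂ • Td n (j + 1))
      = matAct (scaledShear j i (β / α) v₂) (r₂ • Td n j) := by
    rw [matAct_scaledShear_smul_Td hij.ne (by omega) (by omega) hα hβ hαβ hr₁ hs hv₁ hv₁j,
      matAct_scaledShear_smul_Td hij.ne' (by omega) (by omega) hβ hα hβα hr₂ hs hv₂ hv₂i,
      matAct_scaledShear_smul_Td_facet hij hα hβ hβα hr₂ hs hv₂ hv₂i]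
    ext y
    constructor
    · rintro ⟨⟨h1, h2⟩, -, h3⟩
      exact ⟨h1, le_antisymm h3 h2⟩
    · rintro ⟨h1, h2⟩
      exact ⟨⟨h1, h2.ge⟩, h1, h2.le⟩
  have h := hval _ _ hK hL (hunion ▸ hU) (hinter ▸ hI)
  rw [hunion, hinter] at h
  rw [← supp_convexHull_union (hbody _ hU) (hbody _ hI), h,
    supp_convexHull_union (hbody _ hK) (hbody _ hL)]

end Dissection

section Symmetry

variable {n : ℕ}

lemma scaledShear_transpose_bvec {i j m : Fin n} (hmi : m ≠ i) (hmj : m ≠ j) (c : ℝ)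
    (v : Fin n → ℝ) : (scaledShear i j c v)ᵀ.toEuclideanLin (bvec m) = v m • bvec m := by
  ext l
  rw [scaledShear_transpose_apply]
  by_cases hlm : l = m
  · subst hlm; simp [bvec, hmj]
  · simp [bvec, hlm, hmi.symm]

lemma supp_smul_Td_bvec {Z : Set (Euc n) → Set (Euc n)} (hcov : SLCovariant Z) {d : ℕ}
    {i k : Fin n} (hik : i ≠ k) (hk : d ≤ k) {s : ℝ} (hs : 0 < s) :
    supp (Z (s • Td n d)) (bvec i) = s * supp (Z (Td n d)) (bvec i) := by
  let v : Fin n → ℝ := Function.update (fun _ => s) k (s ^ (n - 1))⁻¹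
  have hprod : ∏ l, v l = 1 := by
    rw [Finset.prod_update_of_mem (Finset.mem_univ _)]
    simp [Finset.card_sdiff, hs.ne']
  have hdet := (det_scaledShear hik 0 v).trans hprod
  have hact : matAct (scaledShear i k 0 v) (Td n d) = s • Td n d := by
    rw [← Set.image_smul]
    refine Set.image_congr fun y hy => ?_
    ext l
    rw [scaledShear_apply]
    by_cases hl : l = k
    · subst hl
      simp [(mem_Td.1 hy).2.1 l hk]
    · simp [v, hl]
  have htr : (scaledShear i k 0 v)ᵀ.toEuclideanLin (bvec i) = s • bvec i := by
    ext l
    rw [scaledShear_transpose_apply]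
    by_cases hl : l = i
    · subst hl; simp [bvec, v, hik]
    · simp [bvec, hl]
  have hP : IsPolytope0 (Td n d) := by simpa using isPolytope0_smul_Td (n := n) d 1
  rw [← hact, hcov.supp_eq hdet hP, htr, supp_smul _ hs.le]

lemma supp_Td_bvec_add {Z : Set (Euc n) → Set (Euc n)} (hcov : SLCovariant Z) {i j : Fin n}
    (hij : i ≠ j) (t : ℝ) :
    supp (Z (Td n j)) (bvec i + t • bvec j) = supp (Z (Td n j)) (bvec i) := by
  have hdet : (scaledShear i j t fun _ => 1).det = 1 := by
    rw [det_scaledShear hij, Finset.prod_const_one]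
  have hact : matAct (scaledShear i j t fun _ => 1) (Td n j) = Td n j := by
    refine (Set.image_congr fun y hy => ?_).trans (Set.image_id _)
    ext l
    simp [scaledShear_apply, (mem_Td.1 hy).2.1 j le_rfl]
  have htr : (scaledShear i j t fun _ => 1)ᵀ.toEuclideanLin (bvec i) = bvec i + t • bvec j := by
    ext l
    rw [scaledShear_transpose_apply]
    by_cases hl : l = j <;> simp [bvec, hl]
  have hP : IsPolytope0 (Td n j) := by simpa using isPolytope0_smul_Td (n := n) j 1
  have h := hcov.supp_eq hdet hP (bvec i)
  rwa [hact, htr, eq_comm] at h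

/-- Exchanging `eᵢ` and `eⱼ` is a symmetry of `Z T^d` in directions orthogonal to some `eₖ` with
`k` outside the support of `T^d`. -/
lemma supp_Td_swap {Z : Set (Euc n) → Set (Euc n)} (hcov : SLCovariant Z) {d : ℕ}
    {i j k : Fin n} (hij : i ≠ j) (hi : (i : ℕ) < d) (hj : (j : ℕ) < d) (hk : d ≤ k) (t : ℝ) :
    supp (Z (Td n d)) (bvec i + t • bvec j) = supp (Z (Td n d)) (bvec j + t • bvec i) := by
  have hki : k ≠ i := by rintro rfl; omega
  have hkj : k ≠ j := by rintro rfl; omega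
  let σ := Equiv.swap i j
  let v : Fin n → ℝ := Function.update 1 k (-1)
  let M : Matrix (Fin n) (Fin n) ℝ := σ.permMatrix ℝ * diagonal v
  have hdet : M.det = 1 := by
    rw [det_mul, det_permutation, det_diagonal, Finset.prod_update_of_mem (Finset.mem_univ _),
      Equiv.Perm.sign_swap hij]
    simp
  have happ : ∀ (y : Euc n) l, M.toEuclideanLin y l = v (σ l) * y (σ l) := by
    intro y l
    simp only [M, Matrix.ofLp_toLpLin, Matrix.toLin'_apply]
    rw [← mulVec_mulVec, permMatrix_mulVec]
    simp [mulVec_diagonal]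
  have htrapp : ∀ (x : Euc n) l, Mᵀ.toEuclideanLin x l = v l * x (σ l) := by
    intro x l
    simp only [M, Matrix.ofLp_toLpLin, Matrix.toLin'_apply, transpose_mul, diagonal_transpose]
    rw [← mulVec_mulVec, mulVec_diagonal, mulVec_transpose, vecMul_permMatrix]
    simp [σ]
  have hσd : ∀ l : Fin n, d ≤ l → σ l = l := by
    intro l hl
    exact Equiv.swap_apply_of_ne_of_ne (by rintro rfl; omega) (by rintro rfl; omega)
  have hperm : ∀ y ∈ Td n d, (WithLp.toLp 2 fun l => y (σ l) : Euc n) ∈ Td n d := by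
    intro y hy
    obtain ⟨h0, h1, h2⟩ := mem_Td.1 hy
    exact mem_Td.2 ⟨fun l => h0 _, fun l hl => by simpa [hσd l hl] using h1 l hl,
      (Equiv.sum_comp σ fun l => y l).trans_le h2⟩
  have hM : ∀ y ∈ Td n d, M.toEuclideanLin y = WithLp.toLp 2 fun l => y (σ l) := by
    intro y hy
    ext l
    rw [happ]
    by_cases hl : σ l = k
    · simp [hl, (mem_Td.1 hy).2.1 k hk]
    · simp [v, hl]
  have hact : matAct M (Td n d) = Td n d := by
    ext x
    constructor
    · rintro ⟨y, hy, rfl⟩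
      rw [hM y hy]
      exact hperm y hy
    · intro hx
      refine ⟨_, hperm x hx, ?_⟩
      rw [hM _ (hperm x hx)]
      ext l
      simp [σ]
  have htr : Mᵀ.toEuclideanLin (bvec i + t • bvec j) = bvec j + t • bvec i := by
    ext l
    rw [htrapp]
    by_cases h1 : l = i
    · subst h1; simp [bvec, σ, v, hij, hki.symm, hij.symm]
    · by_cases h2 : l = j
      · subst h2; simp [bvec, σ, v, h1, hkj.symm, hij]
      · simp [bvec, σ, h1, h2, Equiv.swap_apply_of_ne_of_ne h1 h2]
  have hP : IsPolytope0 (Td n d) := by simpa using isPolytope0_smul_Td (n := n) d 1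
  have h := hcov.supp_eq hdet hP (bvec i + t • bvec j)
  rwa [hact, htr] at h

end Symmetry

section Monotonicity

variable {n : ℕ}

lemma prod_update_update_one {j k : Fin n} (hjk : j ≠ k) {β : ℝ} (hβ : β ≠ 0) :
    ∏ l, Function.update (Function.update (1 : Fin n → ℝ) j β) k β⁻¹ l = 1 := by
  rw [Finset.prod_update_of_mem (Finset.mem_univ _), Finset.prod_update_of_mem (by simpa using hjk)]
  simp [hβ]

lemma supp_Td_le_succ {Z : Set (Euc n) → Set (Euc n)}
    (hbody : ∀ P : Set (Euc n), IsPolytope0 P → IsConvexBody0 (Z P))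
    (hval : ValuationInf Z) (hcov : SLCovariant Z) {i j k : Fin n} (hij : i < j) (hjk : j < k) :
    supp (Z (Td n j)) (bvec i) ≤ supp (Z (Td n (j + 1))) (bvec i) := by
  have hik := hij.trans hjk
  have hjk' : (j : ℕ) < k := hjk
  let v : Fin n → ℝ → Fin n → ℝ := fun m β =>
    Function.update (Function.update (1 : Fin n → ℝ) m β) k β⁻¹
  have hv : ∀ m < k, ∀ β, ∀ l : Fin n, (l : ℕ) < (j : ℕ) + 1 → l ≠ m → 1 * v m β l = 1 := by
    intro m hm β l hl hlm
    have hlk : l ≠ k := by rintro rfl; omega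
    simp [v, hlk, hlm]
  have hvm : ∀ m < k, ∀ β, v m β m = β := by
    intro m hm β
    simp [v, hm.ne]
  have hvk : ∀ m l β, l ≠ m → l ≠ k → v m β l = 1 := by
    intro m l β h1 h2
    simp [v, h1, h2]
  have key : ∀ α β : ℝ, 0 < α → 0 < β → α + β = 1 → ∀ x : Euc n,
      max (supp (Z (Td n (j + 1))) x)
          (supp (Z (Td n j)) ((scaledShear j i (β / α) (v i α))ᵀ.toEuclideanLin x))
        = max (supp (Z (Td n (j + 1))) ((scaledShear i j (α / β) (v j β))ᵀ.toEuclideanLin x))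
          (supp (Z (Td n (j + 1))) ((scaledShear j i (β / α) (v i α))ᵀ.toEuclideanLin x)) := by
    intro α β hα hβ hαβ x
    have := supp_dissection hbody hval hcov hij hα hβ hαβ one_pos one_pos one_pos
      (hv j hjk β) (by rw [hvm j hjk]; ring) (hv i hik α) (by rw [hvm i hik]; ring)
      (prod_update_update_one hjk.ne hβ.ne') (prod_update_update_one hik.ne hα.ne') x
    simpa only [one_smul] using this
  have hP : ∀ d, IsPolytope0 (Td n d) := fun d => by
    simpa using isPolytope0_smul_Td (n := n) d 1
  set a := supp (Z (Td n j)) (bvec i) with ha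
  set c := supp (Z (Td n (j + 1))) (bvec i) with hc
  have hc0 : 0 ≤ c := supp_nonneg (hbody _ (hP _)) _
  by_contra! hlt
  have ha0 : 0 < a := hc0.trans_lt hlt
  have hdiag : a ≤ supp (Z (Td n (j + 1))) (bvec i + bvec j) := by
    have h := key (1 / 2) (1 / 2) (by norm_num) (by norm_num) (by norm_num) (bvec i + bvec j)
    have h1 : (scaledShear j i ((1 / 2) / (1 / 2)) (v i (1 / 2)))ᵀ.toEuclideanLin
        (bvec i + bvec j) = bvec i + bvec j := by
      ext l
      rw [scaledShear_transpose_apply]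
      by_cases hli : l = i
      · subst hli; rw [hvm l hik]; simp [bvec, hij.ne, hij.ne']; norm_num
      · by_cases hlj : l = j
        · subst hlj; rw [hvk i l _ hli hjk.ne]; simp [bvec, hli]
        · simp [bvec, hli, hlj]
    have h2 : (scaledShear i j ((1 / 2) / (1 / 2)) (v j (1 / 2)))ᵀ.toEuclideanLin
        (bvec i + bvec j) = bvec i + bvec j := by
      ext l
      rw [scaledShear_transpose_apply]
      by_cases hlj : l = j
      · subst hlj; rw [hvm l hjk]; simp [bvec, hij.ne, hij.ne']; norm_num
      · by_cases hli : l = i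
        · subst hli; rw [hvk j l _ hlj hik.ne]; simp [bvec, hlj]
        · simp [bvec, hli, hlj]
    rw [h1, h2, max_self] at h
    have h3 := supp_Td_bvec_add hcov hij.ne 1
    rw [one_smul] at h3
    rw [ha, ← h3, ← h]
    exact le_max_right _ _
  have hside : ∀ t : ℝ, 0 < t → t < 1 →
      supp (Z (Td n (j + 1))) (bvec i + t • bvec j) ≤ max c (t * a) := by
    intro t ht0 ht1
    have h := key t (1 - t) ht0 (by linarith) (by ring) (bvec i)
    have h1 : (scaledShear j i ((1 - t) / t) (v i t))ᵀ.toEuclideanLin (bvec i)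
        = t • bvec i := by
      ext l
      rw [scaledShear_transpose_apply]
      by_cases hli : l = i
      · subst hli; rw [hvm l hik]; simp [bvec, hij.ne']
      · simp [bvec, hli]
    have h2 : (scaledShear i j (t / (1 - t)) (v j (1 - t)))ᵀ.toEuclideanLin (bvec i)
        = bvec i + t • bvec j := by
      ext l
      rw [scaledShear_transpose_apply]
      by_cases hlj : l = j
      · subst hlj
        have : 1 - t ≠ 0 := by linarith
        rw [hvm l hjk]
        simp [bvec, hij.ne']
        field_simp
      · by_cases hli : l = i
        · subst hli; rw [hvk j l _ hlj hik.ne]; simp [bvec, hlj]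
        · simp [bvec, hli, hlj]
    rw [h1, h2, supp_smul _ ht0.le] at h
    rw [hc, ha, h]
    exact le_max_left _ _
  obtain ⟨t, ht, ht1⟩ := exists_between ((div_lt_one ha0).2 hlt)
  have ht0 : 0 < t := (div_nonneg hc0 ha0.le).trans_lt ht
  have hct : c < t * a := (div_lt_iff₀ ha0).1 ht
  have hs := hside t ht0 ht1
  rw [max_eq_right hct.le] at hs
  have hs' := hs
  rw [supp_Td_swap hcov hij.ne (by omega) (by omega) (Nat.succ_le_of_lt hjk')] at hs'
  have hadd := supp_add_le (hbody _ (hP (j + 1))) (bvec i + t • bvec j) (bvec j + t • bvec i)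
  have hsum : bvec i + t • bvec j + (bvec j + t • bvec i)
      = (1 + t) • (bvec i + bvec j : Euc n) := by module
  rw [hsum, supp_smul _ (by linarith)] at hadd
  nlinarith

end Monotonicity

section FullDimension

lemma eq_of_max_add_eq {g : ℝ → ℝ} {a : ℝ}
    (hg : ∀ x y, 0 < x → 0 < y → max (g (x + y)) a = max (g x) (g y)) :
    (∀ x, 0 < x → a ≤ g x) ∧ ∀ x y, 0 < x → 0 < y → g x = g y := by
  have hle : ∀ x, 0 < x → a ≤ g x := by
    intro x hx
    rw [← max_self (g x), ← hg x x hx hx]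
    exact le_max_right _ _
  have hadd : ∀ x y, 0 < x → 0 < y → g (x + y) = max (g x) (g y) := by
    intro x y hx hy
    rw [← hg x y hx hy, max_eq_left (hle _ (by positivity))]
  have hmono : ∀ x y, 0 < x → x < y → g x ≤ g y := by
    intro x y hx hxy
    rw [show y = x + (y - x) by ring, hadd x _ hx (by linarith)]
    exact le_max_left _ _
  have hpow : ∀ (k : ℕ) x, 0 < x → g (2 ^ k * x) = g x := by
    intro k x hx
    induction k with
    | zero => simp
    | succ k ih =>
      rw [pow_succ, show (2 : ℝ) ^ k * 2 * x = 2 ^ k * x + 2 ^ k * x by ring,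
        hadd _ _ (by positivity) (by positivity), max_self, ih]
  have hanti : ∀ x y, 0 < x → 0 < y → g y ≤ g x := by
    intro x y hx hy
    obtain ⟨k, hk⟩ := pow_unbounded_of_one_lt (y / x) one_lt_two
    rw [← hpow k x hx]
    exact hmono _ _ hy ((div_lt_iff₀ hx).1 hk)
  exact ⟨hle, fun x y hx hy => le_antisymm (hanti y x hy hx) (hanti x y hx hy)⟩

lemma eq_of_max_root_eq {n : ℕ} (hn : n ≠ 0) {f : ℝ → ℝ} {a : ℝ}
    (hf : ∀ r₁ r₂ s, 0 < r₁ → 0 < r₂ → 0 < s → r₁ ^ n + r₂ ^ n = s ^ n →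
      max (f s) a = max (f r₁) (f r₂)) :
    (∀ r, 0 < r → a ≤ f r) ∧ ∀ r s, 0 < r → 0 < s → f r = f s := by
  have hroot : ∀ x : ℝ, 0 < x → (x ^ ((n : ℝ)⁻¹)) ^ n = x := fun x hx =>
    Real.rpow_inv_natCast_pow hx.le hn
  have hpow : ∀ r : ℝ, 0 < r → (r ^ n) ^ ((n : ℝ)⁻¹) = r := fun r hr =>
    Real.pow_rpow_inv_natCast hr.le hn
  obtain ⟨h1, h2⟩ := eq_of_max_add_eq (g := fun x => f (x ^ ((n : ℝ)⁻¹))) (a := a)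
    fun x y hx hy => hf _ _ _ (by positivity) (by positivity) (by positivity)
      (by rw [hroot x hx, hroot y hy, hroot _ (by positivity)])
  refine ⟨fun r hr => ?_, fun r s hr hs => ?_⟩
  · simpa only [hpow r hr] using h1 (r ^ n) (by positivity)
  · simpa only [hpow r hr, hpow s hs] using
      h2 (r ^ n) (s ^ n) (by positivity) (by positivity)

variable {n : ℕ}

lemma supp_smul_Td_full {Z : Set (Euc n) → Set (Euc n)}
    (hbody : ∀ P : Set (Euc n), IsPolytope0 P → IsConvexBody0 (Z P))
    (hval : ValuationInf Z) (hcov : SLCovariant Z) {m i j : Fin n} (hij : i < j)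
    (hmi : m ≠ i) (hmj : m ≠ j) (hj : (j : ℕ) + 1 = n) :
    (∀ s : ℝ, 0 < s → supp (Z (s • Td n (j + 1))) (bvec m)
      = s * supp (Z (Td n (j + 1))) (bvec m)) ∧
    supp (Z (Td n j)) (bvec m) ≤ supp (Z (Td n (j + 1))) (bvec m) := by
  have hn : n ≠ 0 := by omega
  obtain ⟨h1, h2⟩ := eq_of_max_root_eq hn
    (f := fun r => supp (Z (r • Td n (j + 1))) (bvec m) / r)
    (a := supp (Z (Td n j)) (bvec m)) (by
      intro r₁ r₂ s hr₁ hr₂ hs hsum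
      let v : Fin n → ℝ → Fin n → ℝ := fun q r => Function.update (fun _ => s / r) q
        ((r / s) ^ n * (s / r))
      have hv : ∀ q r, 0 < r → ∀ l : Fin n, (l : ℕ) < (j : ℕ) + 1 → l ≠ q → r * v q r l = s := by
        intro q r hr l _ hl
        simp only [v, Function.update_of_ne hl]
        field_simp
      have hvq : ∀ q r, 0 < r → r * v q r q = (r / s) ^ n * s := by
        intro q r hr
        simp only [v, Function.update_self]
        field_simp
      have hprod : ∀ q r, 0 < r → ∏ l, v q r l = 1 := by
        intro q r hr
        rw [Finset.prod_update_of_mem (Finset.mem_univ _), Finset.prod_const,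
          Finset.card_sdiff_of_subset (Finset.subset_univ _), Finset.card_univ, Fintype.card_fin,
          Finset.card_singleton, mul_assoc, ← pow_succ', Nat.sub_add_cancel (by omega), ← mul_pow]
        have : r / s * (s / r) = 1 := by field_simp
        rw [this, one_pow]
      have hαβ : (r₂ / s) ^ n + (r₁ / s) ^ n = 1 := by
        rw [div_pow, div_pow, ← add_div, add_comm, hsum, div_self (by positivity)]
      have h := supp_dissection hbody hval hcov hij (by positivity) (by positivity) hαβ hr₁ hr₂ hs
        (hv j r₁ hr₁) (hvq j r₁ hr₁) (hv i r₂ hr₂) (hvq i r₂ hr₂) (hprod j r₁ hr₁)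
        (hprod i r₂ hr₂) (bvec m)
      rw [scaledShear_transpose_bvec hmi hmj, scaledShear_transpose_bvec hmj hmi] at h
      have hvm₁ : v j r₁ m = s / r₁ := Function.update_of_ne hmj _ _
      have hvm₂ : v i r₂ m = s / r₂ := Function.update_of_ne hmi _ _
      rw [hvm₁, hvm₂, supp_smul _ (by positivity), supp_smul _ (by positivity),
        supp_smul _ (by positivity), supp_smul_Td_bvec hcov hmj le_rfl hr₂] at h
      have e1 : s / r₂ * (r₂ * supp (Z (Td n j)) (bvec m)) = s * supp (Z (Td n j)) (bvec m) := by
        field_simp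
      have e2 : ∀ r b : ℝ, s / r * b = s * (b / r) := fun r b => by ring
      have e3 : supp (Z (s • Td n (j + 1))) (bvec m)
          = s * (supp (Z (s • Td n (j + 1))) (bvec m) / s) := by field_simp
      rw [e1, e2, e2, e3, ← mul_max_of_nonneg _ _ hs.le, ← mul_max_of_nonneg _ _ hs.le] at h
      exact mul_left_cancel₀ hs.ne' h)
  refine ⟨fun s hs => ?_, by simpa using h1 1 one_pos⟩
  have := h2 s 1 hs one_pos
  simp only [one_smul, div_one] at this
  rw [← this]
  field_simp

end FullDimension

lemma supp_Td_homogeneous_and_mono {n : ℕ} (hn : 3 ≤ n) (h₀ : 0 < n)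
    {Z : Set (Euc n) → Set (Euc n)}
    (hbody : ∀ P : Set (Euc n), IsPolytope0 P → IsConvexBody0 (Z P))
    (hval : ValuationInf Z) (hcov : SLCovariant Z) :
    (∀ d : ℕ, 1 ≤ d → d ≤ n → ∀ s : ℝ, 0 < s →
      supp (Z (s • Td n d)) (bvec ⟨0, h₀⟩)
        = s * supp (Z (Td n d)) (bvec ⟨0, h₀⟩)) ∧
    (∀ d : ℕ, 1 ≤ d → d < n →
      supp (Z (Td n d)) (bvec ⟨0, h₀⟩)
        ≤ supp (Z (Td n (d + 1))) (bvec ⟨0, h₀⟩)) := by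
  have hfull := supp_smul_Td_full hbody hval hcov (m := ⟨0, h₀⟩) (i := ⟨1, by omega⟩)
    (j := ⟨n - 1, by omega⟩) (Fin.mk_lt_mk.2 (by omega)) (by simp)
    (by rw [Ne, Fin.mk.injEq]; omega) (Nat.sub_add_cancel (by omega))
  refine ⟨fun d _ hd s hs => ?_, fun d hd hdn => ?_⟩
  · rcases hd.eq_or_lt with rfl | hlt
    · have := hfull.1 s hs
      simpa only [Nat.sub_add_cancel (show 1 ≤ d by omega)] using this
    · exact supp_smul_Td_bvec hcov (k := ⟨n - 1, by omega⟩) (by rw [Ne, Fin.mk.injEq]; omega)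
        (Nat.le_sub_one_of_lt hlt) hs
  · rcases (Nat.succ_le_of_lt hdn).eq_or_lt with heq | hlt
    · obtain rfl : d = n - 1 := by omega
      exact hfull.2
    · exact supp_Td_le_succ hbody hval hcov (i := ⟨0, h₀⟩) (j := ⟨d, hdn⟩)
        (k := ⟨n - 1, by omega⟩) (Fin.mk_lt_mk.2 (by omega)) (Fin.mk_lt_mk.2 (by omega))

/-- Lemma 4.2: for `n ≥ 3`, if `Z : P_o^n → K_o^n` is an `SL(n)` covariant `L_∞` Minkowski
valuation, then `h_{Z(sT^d)}(± e₁) = s h_{Z(T^d)}(± e₁)` for `1 ≤ d ≤ n`, `s > 0`, and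
`h_{Z(T^1)}(± e₁) ≤ … ≤ h_{Z(T^n)}(± e₁)`. -/
theorem sln_covariant_Linfty_homogeneity (n : ℕ) (hn : 3 ≤ n)
    (Z : Set (Euc n) → Set (Euc n))
    (hbody : ∀ P : Set (Euc n), IsPolytope0 P → IsConvexBody0 (Z P))
    (hval : ValuationInf Z) (hcov : SLCovariant Z) :
    (∀ d : ℕ, 1 ≤ d → d ≤ n → ∀ s : ℝ, 0 < s →
      supp (Z (s • Td n d)) (bvec ⟨0, by omega⟩) = s * supp (Z (Td n d)) (bvec ⟨0, by omega⟩) ∧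
      supp (Z (s • Td n d)) (-bvec ⟨0, by omega⟩)
        = s * supp (Z (Td n d)) (-bvec ⟨0, by omega⟩)) ∧
    (∀ d : ℕ, 1 ≤ d → d < n →
      supp (Z (Td n d)) (bvec ⟨0, by omega⟩) ≤ supp (Z (Td n (d + 1))) (bvec ⟨0, by omega⟩) ∧
      supp (Z (Td n d)) (-bvec ⟨0, by omega⟩)
        ≤ supp (Z (Td n (d + 1))) (-bvec ⟨0, by omega⟩)) := by
  obtain ⟨h1, h2⟩ := supp_Td_homogeneous_and_mono hn (by omega) hbody hval hcov
  obtain ⟨h3, h4⟩ := supp_Td_homogeneous_and_mono hn (by omega)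
    (fun P hP => (hbody P hP).neg) hval.neg hcov.neg
  simp only [supp_neg] at h3 h4
  exact ⟨fun d hd hdn s hs => ⟨h1 d hd hdn s hs, h3 d hd hdn s hs⟩,
    fun d hd hdn => ⟨h2 d hd hdn, h4 d hd hdn⟩⟩
end
end

section
/- Let 0 ≤ m ≤ d ≤ n and let v₀ ∈ ℝ^n be such that the origin lies in the relative interior of [v₀, e₁, …, e_m]. For x = (x₁, …, x_d)ᵗ ∈ ℝ^d set α₁ = max{v₀·x, x₁, …, x_m}, α₂ = min{v₀·x, x₁, …, x_m}, β₁ = max{x_{m+1}, …, x_d}, β₂ = min{x_{m+1}, …, x_d}. Then Φ_{p;a₁,a₂}([v₀, e₁, …, e_d])(x) = a₂·max{α₁^p, β₁^p} + (a₂−a₁)(−1)^{m+1}·max{α₁^p, β₂^p} + (a₂−a₁)(−1)^m·α₁^p, and Φ_{p;b₁,b₂}(−[v₀, e₁, …, e_d])(x) = b₂·max{−α₂^p, −β₂^p} + (b₂−b₁)(−1)^{m+1}·max{−α₂^p, −β₁^p} + (b₂−b₁)(−1)^m·(−α₂^p). In particular, for m = 0 and v₀ = o: Φ_{p;a₁,a₂}(T^d)(x)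 = a₂·max{β₁^p, 0} − (a₂−a₁)·max{β₂^p, 0} and Φ_{p;b₁,b₂}(−T^d)(x) = b₂·max{−β₂^p, 0} − (b₂−b₁)·max{−β₁^p, 0}. -/
open scoped RealInnerProductSpace BigOperators Pointwise ENNReal
open MeasureTheory Filter Matrix

noncomputable section

/-- The set of `j`-dimensional faces of `P` containing the origin (faces of a polytope
being exactly its exposed faces). -/
def facesO {n : ℕ} (j : ℕ) (P : Set (Euc n)) : Set (Set (Euc n)) :=
  {F | IsExposed ℝ P F ∧ sdim F = j ∧ (0 : Euc n) ∈ F}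

/-- The function-valued valuation `Φ_{p;a₁,a₂}`:
`Φ_{p;a₁,a₂}(P) = a₁ h_P^p + (a₂-a₁) Σ_{1≤j≤dim P-1} (-1)^j Σ_{F ∈ F_{j,o}(P)} h_F^p` if `dim P` is
odd, and with leading coefficient `2a₂ - a₁` instead of `a₁` if `dim P` is even. -/
def PhiP {n : ℕ} (p a₁ a₂ : ℝ) (P : Set (Euc n)) : Euc n → ℝ := fun x =>
  (if Odd (sdim P) then a₁ else 2 * a₂ - a₁) * supp P x ^ p
    + (a₂ - a₁) * ∑ j ∈ Finset.Icc 1 (sdim P - 1),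
        (-1 : ℝ) ^ j * ∑ᶠ F ∈ facesO j P, supp F x ^ p

/-- The signed `p`-th power `a^p = sgn(a)|a|^p` (with `sgn a = 1` for `a ≥ 0`). -/
def spow (a p : ℝ) : ℝ := if 0 ≤ a then a ^ p else -((-a) ^ p)

section Simplex

variable {n : ℕ}

theorem supp_convexHull_of_isGreatest {T : Set (Euc n)} {x : Euc n} {M : ℝ}
    (h : IsGreatest ((fun y => ⟪x, y⟫) '' T) M) : supp (convexHull ℝ T) x = M := by
  refine IsGreatest.csSup_eq ⟨Set.image_mono (subset_convexHull ℝ T) h.1, ?_⟩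
  rintro _ ⟨y, hy, rfl⟩
  have hT : T ⊆ {y | innerSL ℝ x y ≤ M} := fun z hz => h.2 ⟨z, hz, rfl⟩
  exact convexHull_min hT (convex_halfSpace_le (innerSL ℝ x).isLinear M) hy

theorem spow_neg {p : ℝ} (hp : p ≠ 0) (a : ℝ) : spow (-a) p = -spow a p := by
  unfold spow
  rcases lt_trichotomy a 0 with h | h | h
  · rw [if_pos (by linarith), if_neg (by linarith), neg_neg]
  · simp [h, Real.zero_rpow hp]
  · rw [if_neg (by linarith), if_pos h.le, neg_neg]

theorem max_spow_of_nonneg {p a b : ℝ} (hp : 0 ≤ p) (ha : 0 ≤ a) :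
    max (spow a p) (spow b p) = max a b ^ p := by
  unfold spow
  rw [if_pos ha]
  rcases le_total 0 b with hb | hb
  · rw [if_pos hb]
    rcases le_total a b with h | h
    · rw [max_eq_right h, max_eq_right (Real.rpow_le_rpow ha h hp)]
    · rw [max_eq_left h, max_eq_left (Real.rpow_le_rpow hb h hp)]
  · rw [max_eq_left (hb.trans ha)]
    refine max_eq_left ?_
    split_ifs with h
    · exact Real.rpow_le_rpow h (hb.trans ha) hp
    · exact (neg_nonpos.2 (Real.rpow_nonneg (by linarith) p)).trans (Real.rpow_nonneg ha p)

variable {κ : Type*}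

/-- The convex hull of `v` and the vectors `b k`, `k ∈ S`. -/
def hullWith (b : κ → Euc n) (v : Euc n) (S : Finset κ) : Set (Euc n) :=
  convexHull ℝ (insert v (b '' (S : Set κ)))

theorem LinearIndependent.exists_clm_eq {b : κ → Euc n} (hb : LinearIndependent ℝ b)
    (f : κ → ℝ) : ∃ l : StrongDual ℝ (Euc n), ∀ k, l (b k) = f k := by
  obtain ⟨g, hg⟩ := LinearMap.exists_extend ((Module.Basis.span hb).constr ℝ f)
  refine ⟨LinearMap.toContinuousLinearMap g, fun k => ?_⟩
  have h1 := congrArg (fun L => L (Module.Basis.span hb k)) hg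
  have h2 : Module.Basis.span hb k = ⟨b k, Submodule.subset_span ⟨k, rfl⟩⟩ :=
    Module.Basis.span_apply hb k
  rw [Module.Basis.constr_basis, h2] at h1
  exact h1

theorem left_mem_hullWith (b : κ → Euc n) (v : Euc n) (S : Finset κ) : v ∈ hullWith b v S :=
  subset_convexHull ℝ _ (Set.mem_insert _ _)

theorem mem_hullWith {b : κ → Euc n} {v : Euc n} {S : Finset κ} {k : κ} (hk : k ∈ S) :
    b k ∈ hullWith b v S :=
  subset_convexHull ℝ _ (Set.mem_insert_of_mem _ ⟨k, hk, rfl⟩)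

theorem hullWith_subset {b : κ → Euc n} {v : Euc n} {S : Finset κ} {C : Set (Euc n)}
    (hC : Convex ℝ C) (hv : v ∈ C) (hb : ∀ k ∈ S, b k ∈ C) : hullWith b v S ⊆ C := by
  refine convexHull_min (Set.insert_subset hv ?_) hC
  rintro _ ⟨k, hk, rfl⟩
  exact hb k hk

theorem hullWith_mono {b : κ → Euc n} {v : Euc n} {S T : Finset κ} (h : S ⊆ T) :
    hullWith b v S ⊆ hullWith b v T :=
  hullWith_subset (convex_convexHull ℝ _) (left_mem_hullWith b v T) fun _ hk => mem_hullWith (h hk)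

variable {b : κ → Euc n} {v : Euc n} {c : κ → ℝ} {A S : Finset κ}

theorem zero_mem_hullWith (hc : ∀ k ∈ A, 0 < c k) (hv : v = -∑ k ∈ A, c k • b k) (hA : A ⊆ S) :
    (0 : Euc n) ∈ hullWith b v S := by
  refine hullWith_mono hA ?_
  rcases A.eq_empty_or_nonempty with rfl | hne
  · have : v = 0 := by simpa using hv
    exact this ▸ left_mem_hullWith b v ∅
  have hs : 0 < ∑ k ∈ A, c k := Finset.sum_pos hc hne
  have hz : A.centerMass c b ∈ hullWith b v A :=
    Convex.centerMass_mem (convex_convexHull ℝ _) (fun k hk => (hc k hk).le) hs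
      fun k hk => mem_hullWith hk
  set s := ∑ k ∈ A, c k
  have key := (convex_convexHull ℝ (insert v (b '' (A : Set κ)))) (left_mem_hullWith b v A) hz
    (a := 1 / (1 + s)) (b := s / (1 + s)) (by positivity) (by positivity) (by field_simp)
  have e : A.centerMass c b = s⁻¹ • ∑ k ∈ A, c k • b k := rfl
  have e' : (1 / (1 + s)) • v + (s / (1 + s)) • A.centerMass c b = 0 := by
    rw [e, smul_smul, hv, smul_neg, neg_add_eq_sub, ← sub_smul,
      show s / (1 + s) * s⁻¹ - 1 / (1 + s) = 0 by field_simp; ring, zero_smul]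
  rwa [e'] at key

theorem sdim_hullWith (hb : LinearIndependent ℝ b) (hc : ∀ k ∈ A, 0 < c k)
    (hv : v = -∑ k ∈ A, c k • b k) (hA : A ⊆ S) : sdim (hullWith b v S) = S.card := by
  have h0 := zero_mem_hullWith hc hv hA
  have hspan : (affineSpan ℝ (hullWith b v S)).direction = Submodule.span ℝ (b '' (S : Set κ)) := by
    rw [direction_affineSpan, vectorSpan_eq_span_vsub_set_right ℝ h0]
    simp only [vsub_eq_sub, sub_zero, Set.image_id']
    refine le_antisymm (Submodule.span_le.2 ?_) (Submodule.span_mono ?_)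
    · refine hullWith_subset (Submodule.convex _) ?_ fun k hk => Submodule.subset_span ⟨k, hk, rfl⟩
      rw [hv]
      exact neg_mem (sum_mem fun k hk => Submodule.smul_mem _ _ (Submodule.subset_span
        ⟨k, hA hk, rfl⟩))
    · rintro _ ⟨k, hk, rfl⟩
      exact mem_hullWith hk
  rw [sdim, hspan, Set.image_eq_range]
  have := finrank_span_eq_card (R := ℝ) (hb.comp (fun k : (S : Set κ) => (k : κ))
    Subtype.val_injective)
  simpa [Function.comp_def] using this

theorem exists_clm_hullWith [DecidableEq κ] (hb : LinearIndependent ℝ b)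
    (hv : v = -∑ k ∈ A, c k • b k) (hA : A ⊆ S) :
    ∃ l : StrongDual ℝ (Euc n), (∀ k, l (b k) ≤ 0) ∧ l v = 0 ∧ ∀ k, k ∈ S ↔ l (b k) = 0 := by
  obtain ⟨l, hl⟩ := hb.exists_clm_eq fun k => if k ∈ S then 0 else -1
  refine ⟨l, fun k => ?_, ?_, fun k => ?_⟩
  · rw [hl]; split_ifs <;> norm_num
  · rw [hv, map_neg, map_sum, Finset.sum_eq_zero, neg_zero]
    intro k hk
    rw [map_smul, hl, if_pos (hA hk), smul_zero]
  · rw [hl]; split_ifs with h <;> simp [h]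

theorem hullWith_injOn [DecidableEq κ] (hb : LinearIndependent ℝ b)
    (hv : v = -∑ k ∈ A, c k • b k) : Set.InjOn (hullWith b v) {S : Finset κ | A ⊆ S} := by
  have key : ∀ S T : Finset κ, A ⊆ S → hullWith b v T ⊆ hullWith b v S → T ⊆ S := by
    intro S T hA h k hk
    obtain ⟨l, -, h2, h3⟩ := exists_clm_hullWith hb hv hA
    have hzero : hullWith b v S ⊆ {y | l y = 0} :=
      hullWith_subset (convex_hyperplane l.isLinear 0) h2 fun k hk => (h3 k).1 hk
    exact (h3 k).2 (hzero (h (mem_hullWith hk)))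
  intro S hS T hT h
  exact (key T S hT h.le).antisymm (key S T hS h.ge)

theorem supp_hullWith {x : Euc n} {M : ℝ} (b : κ → Euc n) (v : Euc n) (S : Finset κ)
    (h : IsGreatest (insert ⟪x, v⟫ ((fun k => ⟪x, b k⟫) '' (S : Set κ))) M) :
    supp (hullWith b v S) x = M := by
  refine supp_convexHull_of_isGreatest ?_
  rwa [Set.image_insert_eq, Set.image_image]

theorem supp_hullWith_insert [DecidableEq κ] (b : κ → Euc n) (v : Euc n) (S : Finset κ)
    {x : Euc n} {j k : κ} (hj : j ∈ S) (hkj : ⟪x, b k⟫ ≤ ⟪x, b j⟫) :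
    supp (hullWith b v (insert k S)) x = supp (hullWith b v S) x := by
  obtain ⟨M, hM⟩ := ((S.finite_toSet.image fun k => ⟪x, b k⟫).insert ⟪x, v⟫).isCompact.exists_isGreatest
    (Set.insert_nonempty _ _)
  rw [supp_hullWith b v S hM]
  refine supp_hullWith b v _ ?_
  rw [Finset.coe_insert, Set.image_insert_eq, Set.insert_comm]
  refine ⟨Set.mem_insert_of_mem _ hM.1, ?_⟩
  rintro _ (rfl | h)
  · exact hkj.trans (hM.2 (Set.mem_insert_of_mem _ ⟨j, hj, rfl⟩))
  · exact hM.2 h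

variable [Fintype κ]

theorem hullWith_eq_of_clm {l : StrongDual ℝ (Euc n)} (h0 : (0 : Euc n) ∈ hullWith b v S)
    (hl : ∀ k, l (b k) ≤ 0) (hlv : l v = 0) (hS : ∀ k, k ∈ S ↔ l (b k) = 0) :
    hullWith b v S =
      {y ∈ hullWith b v Finset.univ | ∀ z ∈ hullWith b v Finset.univ, l z ≤ l y} := by
  have hle : ∀ z ∈ hullWith b v Finset.univ, l z ≤ 0 ∧ (l z = 0 → z ∈ hullWith b v S) := by
    refine hullWith_subset (C := {z | l z ≤ 0 ∧ (l z = 0 → z ∈ hullWith b v S)}) ?_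
      ⟨hlv.le, fun _ => left_mem_hullWith b v S⟩
      fun k _ => ⟨hl k, fun h => mem_hullWith ((hS k).2 h)⟩
    rintro y ⟨hy, hy'⟩ z ⟨hz, hz'⟩ s t hs ht hst
    have e : l (s • y + t • z) = s * l y + t * l z := by simp
    have h1 := mul_nonpos_of_nonneg_of_nonpos hs hy
    have h2 := mul_nonpos_of_nonneg_of_nonpos ht hz
    refine ⟨by rw [e]; linarith, fun h => ?_⟩
    rw [e] at h
    have h3 : s * l y = 0 := by linarith
    have h4 : t * l z = 0 := by linarith
    rcases mul_eq_zero.1 h3 with rfl | h3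
    · have : t = 1 := by linarith
      subst this
      simpa using hz' (by simpa using h4)
    rcases mul_eq_zero.1 h4 with rfl | h4
    · have : s = 1 := by linarith
      subst this
      simpa using hy' (by simpa using h3)
    exact (convex_convexHull ℝ _) (hy' h3) (hz' h4) hs ht hst
  have hzero : ∀ y ∈ hullWith b v S, l y = 0 :=
    hullWith_subset (C := {y | l y = 0}) (convex_hyperplane l.isLinear 0) hlv fun k hk => (hS k).1 hk
  ext y
  constructor
  · intro hy
    exact ⟨hullWith_mono (Finset.subset_univ S) hy, fun z hz => (hzero y hy).symm ▸ (hle z hz).1⟩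
  · rintro ⟨hy, hmax⟩
    have := hmax 0 (hullWith_mono (Finset.subset_univ S) h0)
    rw [map_zero] at this
    exact (hle y hy).2 (le_antisymm (hle y hy).1 this)

theorem facesO_hullWith [DecidableEq κ] (hb : LinearIndependent ℝ b) (hc : ∀ k ∈ A, 0 < c k)
    (hv : v = -∑ k ∈ A, c k • b k) (j : ℕ) :
    facesO j (hullWith b v Finset.univ)
      = hullWith b v '' {S : Finset κ | A ⊆ S ∧ S.card = j} := by
  ext F
  constructor
  · rintro ⟨hF, hd, h0⟩
    obtain ⟨l, rfl⟩ := hF ⟨0, h0⟩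
    have hle : ∀ z ∈ hullWith b v Finset.univ, l z ≤ 0 := by simpa using h0.2
    have hlb : ∀ k, l (b k) ≤ 0 := fun k => hle _ (mem_hullWith (Finset.mem_univ k))
    have hlv := hle v (left_mem_hullWith _ _ _)
    have hnp : ∀ k ∈ A, c k * l (b k) ≤ 0 := fun k hk =>
      mul_nonpos_of_nonneg_of_nonpos (hc k hk).le (hlb k)
    have e : l v = -∑ k ∈ A, c k * l (b k) := by simp [hv]
    have hs : ∑ k ∈ A, c k * l (b k) = 0 :=
      le_antisymm (Finset.sum_nonpos hnp) (by linarith)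
    have hz := (Finset.sum_eq_zero_iff_of_nonpos hnp).1 hs
    have hA : A ⊆ Finset.univ.filter fun k => l (b k) = 0 := fun k hk => by
      simpa [(hc k hk).ne'] using hz k hk
    have key := hullWith_eq_of_clm (l := l) (zero_mem_hullWith hc hv hA) hlb (by rw [e, hs, neg_zero])
      (by simp)
    refine ⟨_, ⟨hA, ?_⟩, key⟩
    rw [← sdim_hullWith hb hc hv hA, key]
    exact hd
  · rintro ⟨S, ⟨hA, rfl⟩, rfl⟩
    obtain ⟨l, h1, h2, h3⟩ := exists_clm_hullWith hb hv hA
    have h0 := zero_mem_hullWith hc hv hA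
    exact ⟨fun _ => ⟨l, hullWith_eq_of_clm h0 h1 h2 h3⟩, sdim_hullWith hb hc hv hA, h0⟩

theorem alternating_sum_supp_hullWith [DecidableEq κ] (b : κ → Euc n) (v : Euc n) (A : Finset κ)
    (x : Euc n) (p : ℝ) {k : κ} (hk : k ∉ A) (hmin : ∀ j ∉ A, ⟪x, b k⟫ ≤ ⟪x, b j⟫) :
    ∑ S ∈ Finset.Icc A Finset.univ, (-1 : ℝ) ^ S.card * supp (hullWith b v S) x ^ p
      = (-1) ^ A.card * supp (hullWith b v A) x ^ p
        + (-1) ^ (A.card + 1) * supp (hullWith b v (insert k A)) x ^ p := by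
  have hins : Finset.univ \ A = insert k (Finset.univ \ insert k A) := by
    ext j
    by_cases h : j = k <;> simp [h, hk]
  have hkB : k ∉ Finset.univ \ insert k A := by simp
  rw [Finset.Icc_eq_image_powerset (Finset.subset_univ A), Finset.sum_image, hins,
    Finset.sum_powerset_insert hkB, ← Finset.sum_add_distrib,
    Finset.sum_eq_single_of_mem ∅ (Finset.empty_mem_powerset _)]
  · rw [Finset.union_empty, Finset.union_insert, Finset.union_empty,
      Finset.card_insert_of_notMem hk]
  · intro S hS hne
    obtain ⟨j, hj⟩ := Finset.nonempty_iff_ne_empty.2 hne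
    have hSB := Finset.mem_powerset.1 hS
    have hjA : j ∉ A := fun h => by simpa [h] using hSB hj
    have hkS : k ∉ A ∪ S := by
      rw [Finset.mem_union]
      rintro (h | h)
      exacts [hk h, hkB (hSB h)]
    rw [Finset.union_insert, Finset.card_insert_of_notMem hkS,
      supp_hullWith_insert b v _ (Finset.mem_union_right A hj) (hmin j hjA)]
    ring
  · intro S hS T hT h
    have hd : ∀ U ∈ (Finset.univ \ A).powerset, (A ∪ U) \ A = U := fun U hU =>
      Finset.union_sdiff_cancel_left
        (Finset.disjoint_of_subset_right (Finset.mem_powerset.1 hU) Finset.disjoint_sdiff)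
    rw [← hd S hS, ← hd T hT]
    exact congrArg (· \ A) h

theorem PhiP_hullWith [DecidableEq κ] (hb : LinearIndependent ℝ b) (hc : ∀ k ∈ A, 0 < c k)
    (hv : v = -∑ k ∈ A, c k • b k) {p : ℝ} (hp : p ≠ 0) (a₁ a₂ : ℝ) {x : Euc n} {α β₁ β₂ : ℝ}
    (hα : IsGreatest (insert ⟪x, v⟫ ((fun k => ⟪x, b k⟫) '' (A : Set κ))) α)
    (hβ₁ : IsGreatest ((fun k => ⟪x, b k⟫) '' {k | k ∉ A}) β₁)
    (hβ₂ : IsLeast ((fun k => ⟪x, b k⟫) '' {k | k ∉ A}) β₂) :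
    PhiP p a₁ a₂ (hullWith b v Finset.univ) x
      = a₂ * max α β₁ ^ p + (a₂ - a₁) * (-1 : ℝ) ^ (A.card + 1) * max α β₂ ^ p
        + (a₂ - a₁) * (-1 : ℝ) ^ A.card * α ^ p := by
  obtain ⟨k, hk, hkβ⟩ := hβ₂.1
  have hsum := alternating_sum_supp_hullWith b v A x p hk fun j hj => by
    have := hβ₂.2 ⟨j, hj, rfl⟩
    rwa [← hkβ] at this
  have hsA := supp_hullWith b v A hα
  have hsk : supp (hullWith b v (insert k A)) x = max α β₂ := by
    refine supp_hullWith b v _ ?_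
    rw [Finset.coe_insert, Set.image_insert_eq, Set.insert_comm, max_comm, ← hkβ]
    exact hα.insert _
  have hsU : supp (hullWith b v Finset.univ) x = max α β₁ := by
    refine supp_hullWith b v _ ?_
    have h := hα.union hβ₁
    have hU : (A : Set κ) ∪ {k | k ∉ A} = (Finset.univ : Finset κ) := by
      ext j
      simp [em]
    rwa [Set.insert_union, ← Set.image_union, hU] at h
  rw [hsA, hsk] at hsum
  have hdim : sdim (hullWith b v Finset.univ) = Fintype.card κ :=
    sdim_hullWith hb hc hv (Finset.subset_univ A)
  have hface : ∀ j, ∑ᶠ F ∈ facesO j (hullWith b v Finset.univ), supp F x ^ p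
      = ∑ S ∈ Finset.Icc A Finset.univ with S.card = j, supp (hullWith b v S) x ^ p := by
    intro j
    rw [facesO_hullWith hb hc hv, finsum_mem_image ((hullWith_injOn hb hv).mono fun S hS => hS.1),
      ← finsum_mem_coe_finset]
    congr! 4
    simp
  have hfib : ∑ j ∈ Finset.range (Fintype.card κ + 1),
      (-1 : ℝ) ^ j * ∑ᶠ F ∈ facesO j (hullWith b v Finset.univ), supp F x ^ p
      = ∑ S ∈ Finset.Icc A Finset.univ, (-1 : ℝ) ^ S.card * supp (hullWith b v S) x ^ p := by
    rw [← Finset.sum_fiberwise_of_maps_to (g := Finset.card) (fun S _ =>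
      Finset.mem_range_succ_iff.2 (Finset.card_le_univ S))]
    refine Finset.sum_congr rfl fun j _ => ?_
    rw [hface, Finset.mul_sum]
    refine Finset.sum_congr rfl fun S hS => ?_
    rw [(Finset.mem_filter.1 hS).2]
  have hbot : ∑ᶠ F ∈ facesO 0 (hullWith b v Finset.univ), supp F x ^ p = 0 := by
    rw [hface]
    refine Finset.sum_eq_zero fun S hS => ?_
    obtain ⟨h1, h2⟩ := Finset.mem_filter.1 hS
    rw [Finset.card_eq_zero] at h2
    subst h2
    have hA : A = ∅ := Finset.subset_empty.1 (Finset.mem_Icc.1 h1).1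
    have hv0 : v = 0 := by simpa [hA] using hv
    rw [supp_hullWith (M := 0) b v ∅ (by simp [hv0]), Real.zero_rpow hp]
  have htop : ∑ᶠ F ∈ facesO (Fintype.card κ) (hullWith b v Finset.univ), supp F x ^ p
      = max α β₁ ^ p := by
    rw [hface, Finset.sum_eq_single_of_mem Finset.univ (by simp), hsU]
    intro S hS hne
    exact absurd ((Finset.card_eq_iff_eq_univ S).1 (Finset.mem_filter.1 hS).2) hne
  have hpos : 0 < Fintype.card κ := Fintype.card_pos_iff.2 ⟨k⟩
  rw [Finset.sum_range_succ, htop, Finset.range_eq_Ico, Finset.sum_eq_sum_Ico_succ_bot hpos, hbot,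
    hsum] at hfib
  rw [PhiP, hdim, hsU, Finset.Icc_sub_one_right_eq_Ico_of_not_isMin (by simpa using hpos.ne')]
  split_ifs with hodd
  · rw [hodd.neg_one_pow] at hfib
    rw [pow_succ] at hfib ⊢
    linear_combination (a₂ - a₁) * hfib
  · rw [(Nat.not_odd_iff_even.1 hodd).neg_one_pow] at hfib
    rw [pow_succ] at hfib ⊢
    linear_combination (a₂ - a₁) * hfib

theorem PhiP_hullWith_eq_spow [DecidableEq κ] (hb : LinearIndependent ℝ b)
    (hc : ∀ k ∈ A, 0 < c k) (hv : v = -∑ k ∈ A, c k • b k) {p : ℝ} (hp : 0 < p) (a₁ a₂ : ℝ)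
    {x : Euc n} {α β₁ β₂ : ℝ}
    (hα : IsGreatest (insert ⟪x, v⟫ ((fun k => ⟪x, b k⟫) '' (A : Set κ))) α)
    (hβ₁ : IsGreatest ((fun k => ⟪x, b k⟫) '' {k | k ∉ A}) β₁)
    (hβ₂ : IsLeast ((fun k => ⟪x, b k⟫) '' {k | k ∉ A}) β₂) :
    PhiP p a₁ a₂ (hullWith b v Finset.univ) x
      = a₂ * max (spow α p) (spow β₁ p)
        + (a₂ - a₁) * (-1 : ℝ) ^ (A.card + 1) * max (spow α p) (spow β₂ p)
        + (a₂ - a₁) * (-1 : ℝ) ^ A.card * spow α p := by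
  have hα0 : 0 ≤ α := by
    have h := hullWith_subset (b := b) (v := v) (S := A) (C := {y | innerSL ℝ x y ≤ α})
      (convex_halfSpace_le (innerSL ℝ x).isLinear α) (hα.2 (Set.mem_insert _ _))
      (fun k hk => hα.2 (Set.mem_insert_of_mem _ ⟨k, hk, rfl⟩))
      (zero_mem_hullWith hc hv subset_rfl)
    simpa using h
  rw [PhiP_hullWith hb hc hv hp.ne' a₁ a₂ hα hβ₁ hβ₂, max_spow_of_nonneg hp.le hα0,
    max_spow_of_nonneg hp.le hα0, spow, if_pos hα0]

end Simplex

section Coordinates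

variable {n m : ℕ} {v₀ : Euc n}

theorem inner_bvec (x : Euc n) (i : Fin n) : ⟪x, bvec i⟫ = x i := by
  simp [bvec, EuclideanSpace.inner_single_right]

theorem linearIndependent_bvec : LinearIndependent ℝ (bvec : Fin n → Euc n) := by
  have h := (EuclideanSpace.basisFun (Fin n) ℝ).orthonormal.linearIndependent
  have e : ⇑(EuclideanSpace.basisFun (Fin n) ℝ) = bvec := by
    ext1 i
    simp [bvec]
  rwa [e] at h

theorem coord_of_mem_convexHull_bvec {y : Euc n}
    (hy : y ∈ convexHull ℝ (bvec '' {i : Fin n | (i : ℕ) < m})) :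
    (∀ i, 0 ≤ y i) ∧ ∑ i, y i = 1 ∧ ∀ i : Fin n, m ≤ (i : ℕ) → y i = 0 := by
  refine convexHull_min (t := {y : Euc n | (∀ i, 0 ≤ y i) ∧ ∑ i, y i = 1 ∧
    ∀ i : Fin n, m ≤ (i : ℕ) → y i = 0}) ?_ ?_ hy
  · rintro _ ⟨j, hj, rfl⟩
    refine ⟨fun i => ?_, ?_, fun i hi => ?_⟩
    · by_cases h : i = j <;> simp [bvec, h]
    · simp [bvec]
    · have : i ≠ j := by
        rintro rfl
        exact absurd hj (not_lt.2 hi)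
      simp [bvec, this]
  · rintro y ⟨hy1, hy2, hy3⟩ z ⟨hz1, hz2, hz3⟩ s t hs ht hst
    refine ⟨fun i => ?_, ?_, fun i hi => ?_⟩
    · have h1 := mul_nonneg hs (hy1 i)
      have h2 := mul_nonneg ht (hz1 i)
      simpa using add_nonneg h1 h2
    · simp [Finset.sum_add_distrib, ← Finset.mul_sum, hy2, hz2, hst]
    · simp [hy3 i hi, hz3 i hi]

theorem coord_of_zero_mem_convexHull
    (h0 : (0 : Euc n) ∈ convexHull ℝ (insert v₀ (bvec '' {i : Fin n | (i : ℕ) < m}))) :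
    (∀ i, v₀ i ≤ 0) ∧ ∀ i : Fin n, m ≤ (i : ℕ) → v₀ i = 0 := by
  rcases Set.eq_empty_or_nonempty (bvec '' {i : Fin n | (i : ℕ) < m}) with he | hne
  · rw [he, insert_empty_eq, convexHull_singleton] at h0
    simp [← Set.mem_singleton_iff.1 h0]
  rw [convexHull_insert hne, convexJoin_singleton_left] at h0
  simp only [Set.mem_iUnion] at h0
  obtain ⟨z, hz, s, t, hs, ht, hst, h⟩ := h0
  obtain ⟨hz1, hz2, hz3⟩ := coord_of_mem_convexHull_bvec hz
  have hi : ∀ i, s * v₀ i + t * z i = 0 := fun i => by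
    simpa using congrArg (fun y : Euc n => y i) h
  have hs0 : 0 < s := by
    refine hs.lt_of_ne fun hs0 => ?_
    subst hs0
    have ht1 : t = 1 := by linarith
    have : ∑ i, z i = 0 := Finset.sum_eq_zero fun i _ => by simpa [ht1] using hi i
    linarith
  refine ⟨fun i => ?_, fun i hm => ?_⟩
  · have := mul_nonneg ht (hz1 i)
    have := hi i
    by_contra! hpos
    have := mul_pos hs0 hpos
    linarith
  · have := hi i
    rw [hz3 i hm, mul_zero, add_zero] at this
    exact (mul_eq_zero.1 this).resolve_left hs0.ne'

theorem exists_neg_smul_mem_of_zero_mem_intrinsicInterior {s : Set (Euc n)} {e : Euc n}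
    (h0 : (0 : Euc n) ∈ intrinsicInterior ℝ s) (he : e ∈ s) : ∃ t < (0 : ℝ), t • e ∈ s := by
  have hmem : ∀ t : ℝ, t • e ∈ affineSpan ℝ s := fun t => by
    have h := AffineMap.lineMap_mem t (subset_affineSpan ℝ s (intrinsicInterior_subset h0))
      (subset_affineSpan ℝ s he)
    simpa [AffineMap.lineMap_apply] using h
  obtain ⟨y, hy, hy0⟩ := mem_intrinsicInterior.1 h0
  let φ : ℝ → affineSpan ℝ s := fun t => ⟨t • e, hmem t⟩
  have hφ : Continuous φ := by fun_prop
  have hφ0 : φ 0 = y := Subtype.ext (by simp [φ, hy0])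
  have hnhds : ∀ᶠ t in nhds (0 : ℝ), φ t ∈ interior (Subtype.val ⁻¹' s : Set (affineSpan ℝ s)) :=
    hφ.continuousAt.eventually_mem (isOpen_interior.mem_nhds (hφ0 ▸ hy))
  obtain ⟨t, ht, ht0⟩ := ((hnhds.filter_mono nhdsWithin_le_nhds).and
    (self_mem_nhdsWithin (s := Set.Iio (0 : ℝ)))).exists
  have hts : φ t ∈ (Subtype.val ⁻¹' s : Set (affineSpan ℝ s)) := interior_subset ht
  exact ⟨t, ht0, hts⟩

theorem coord_neg_of_zero_mem_intrinsicInterior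
    (h0 : (0 : Euc n) ∈ intrinsicInterior ℝ
      (convexHull ℝ (insert v₀ (bvec '' {i : Fin n | (i : ℕ) < m}))))
    {i : Fin n} (hi : (i : ℕ) < m) : v₀ i < 0 := by
  refine ((coord_of_zero_mem_convexHull (intrinsicInterior_subset h0)).1 i).lt_of_ne fun hv => ?_
  obtain ⟨t, ht, hmem⟩ := exists_neg_smul_mem_of_zero_mem_intrinsicInterior h0
    (subset_convexHull ℝ _ (Set.mem_insert_of_mem _ ⟨i, hi, rfl⟩))
  have hsub : convexHull ℝ (insert v₀ (bvec '' {i : Fin n | (i : ℕ) < m}))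
      ⊆ {y | 0 ≤ EuclideanSpace.proj (𝕜 := ℝ) i y} := by
    refine convexHull_min (Set.insert_subset ?_ ?_)
      (convex_halfSpace_ge (EuclideanSpace.proj (𝕜 := ℝ) i).isLinear 0)
    · simp [hv]
    · rintro _ ⟨j, -, rfl⟩
      by_cases h : i = j <;> simp [bvec, h]
  have h := hsub hmem
  have h' : 0 ≤ t := by simpa [bvec] using h
  linarith

end Coordinates


/-- Proposition 5.1: the values of `Φ_{p;a₁,a₂}([v₀,e₁,…,e_d])` and
`Φ_{p;b₁,b₂}(-[v₀,e₁,…,e_d])`, for `o ∈ relint [v₀,e₁,…,e_m]` and `x` supported on the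
first `d` coordinates; in particular the case `m = 0`, `v₀ = o` of `T^d`. -/
theorem PhiP_value_on_simplices (n m d : ℕ) (hmd : m < d) (hdn : d ≤ n)
    (p a₁ a₂ b₁ b₂ : ℝ) (hp : 1 ≤ p) (v₀ : Euc n)
    (hrel : (0 : Euc n) ∈ intrinsicInterior ℝ
      (convexHull ℝ (insert v₀ (bvec '' {i : Fin n | (i : ℕ) < m}))))
    (x : Euc n) (hx : ∀ i : Fin n, d ≤ (i : ℕ) → x i = 0) :
    let P : Set (Euc n) := convexHull ℝ (insert v₀ (bvec '' {i : Fin n | (i : ℕ) < d}))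
    let α₁ : ℝ := sSup (insert ⟪v₀, x⟫ {r : ℝ | ∃ i : Fin n, (i : ℕ) < m ∧ r = x i})
    let α₂ : ℝ := sInf (insert ⟪v₀, x⟫ {r : ℝ | ∃ i : Fin n, (i : ℕ) < m ∧ r = x i})
    let β₁ : ℝ := sSup {r : ℝ | ∃ i : Fin n, m ≤ (i : ℕ) ∧ (i : ℕ) < d ∧ r = x i}
    let β₂ : ℝ := sInf {r : ℝ | ∃ i : Fin n, m ≤ (i : ℕ) ∧ (i : ℕ) < d ∧ r = x i}
    (PhiP p a₁ a₂ P x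
        = a₂ * max (spow α₁ p) (spow β₁ p)
          + (a₂ - a₁) * (-1 : ℝ) ^ (m + 1) * max (spow α₁ p) (spow β₂ p)
          + (a₂ - a₁) * (-1 : ℝ) ^ m * spow α₁ p) ∧
    (PhiP p b₁ b₂ (-P) x
        = b₂ * max (-spow α₂ p) (-spow β₂ p)
          + (b₂ - b₁) * (-1 : ℝ) ^ (m + 1) * max (-spow α₂ p) (-spow β₁ p)
          + (b₂ - b₁) * (-1 : ℝ) ^ m * (-spow α₂ p)) ∧
    (m = 0 → v₀ = 0 →
      (PhiP p a₁ a₂ P x = a₂ * max (spow β₁ p) 0 - (a₂ - a₁) * max (spow β₂ p) 0) ∧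
      (PhiP p b₁ b₂ (-P) x
        = b₂ * max (-spow β₂ p) 0 - (b₂ - b₁) * max (-spow β₁ p) 0)) := by
  intro P α₁ α₂ β₁ β₂
  let κ := {i : Fin n // (i : ℕ) < d}
  let b : κ → Euc n := fun k => bvec k.1
  let A : Finset κ := Finset.univ.filter fun k => (k.1 : ℕ) < m
  have hp0 : 0 < p := by linarith
  have hb : LinearIndependent ℝ b := linearIndependent_bvec.comp _ Subtype.val_injective
  have hc : ∀ k ∈ A, 0 < -v₀ k.1 := fun k hk =>
    neg_pos.2 (coord_neg_of_zero_mem_intrinsicInterior hrel (Finset.mem_filter.1 hk).2)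
  have hv0 := (coord_of_zero_mem_convexHull (intrinsicInterior_subset hrel)).2
  have hv : v₀ = -∑ k ∈ A, (-v₀ k.1) • b k := by
    ext i
    by_cases hi : (i : ℕ) < m
    · rw [PiLp.neg_apply, WithLp.ofLp_sum, Finset.sum_apply,
        Finset.sum_eq_single_of_mem ⟨i, hi.trans hmd⟩ (by simp [A, hi])]
      · simp [b, bvec]
      · intro k _ hk
        have : i ≠ k.1 := fun h => hk (Subtype.ext h.symm)
        simp [b, bvec, this]
    · rw [PiLp.neg_apply, WithLp.ofLp_sum, Finset.sum_apply, Finset.sum_eq_zero, neg_zero,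
        hv0 i (not_lt.1 hi)]
      intro k hk
      have : i ≠ k.1 := by
        rintro rfl
        exact hi (Finset.mem_filter.1 hk).2
      simp [b, bvec, this]
  have hcard : A.card = m := by
    rw [← Finset.card_range m]
    refine Finset.card_bij (fun k _ => (k.1 : ℕ)) (fun k hk => ?_) (fun k _ l _ h => ?_)
      fun i hi => ?_
    · exact Finset.mem_range.2 (Finset.mem_filter.1 hk).2
    · exact Subtype.ext (Fin.ext h)
    · have hi := Finset.mem_range.1 hi
      exact ⟨⟨⟨i, by omega⟩, hi.trans hmd⟩, by simp [A, hi], rfl⟩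
  have himage : b '' (Finset.univ : Finset κ) = bvec '' {i : Fin n | (i : ℕ) < d} := by
    ext y
    constructor
    · rintro ⟨k, -, rfl⟩
      exact ⟨k.1, k.2, rfl⟩
    · rintro ⟨i, hi, rfl⟩
      exact ⟨⟨i, hi⟩, by simp, rfl⟩
  have hP : P = hullWith b v₀ Finset.univ := by rw [hullWith, himage]
  have hnegP : -P = hullWith (-b) (-v₀) Finset.univ := by
    have e : (-b) '' (Finset.univ : Finset κ) = -(b '' (Finset.univ : Finset κ)) := by
      rw [← Set.image_neg_eq_neg, Set.image_image]
      rfl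
    rw [hP, hullWith, hullWith, ← convexHull_neg, Set.neg_insert, e]
  have hαset : insert ⟪v₀, x⟫ {r : ℝ | ∃ i : Fin n, (i : ℕ) < m ∧ r = x i}
      = insert ⟪x, v₀⟫ ((fun k => ⟪x, b k⟫) '' (A : Set κ)) := by
    rw [real_inner_comm]
    congr 1
    ext r
    constructor
    · rintro ⟨i, hi, rfl⟩
      exact ⟨⟨i, hi.trans hmd⟩, by simp [A, hi], inner_bvec x i⟩
    · rintro ⟨k, hk, rfl⟩
      exact ⟨k.1, (Finset.mem_filter.1 hk).2, inner_bvec x k.1⟩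
  have hβset : {r : ℝ | ∃ i : Fin n, m ≤ (i : ℕ) ∧ (i : ℕ) < d ∧ r = x i}
      = (fun k => ⟪x, b k⟫) '' {k | k ∉ A} := by
    ext r
    constructor
    · rintro ⟨i, hi, hd, rfl⟩
      exact ⟨⟨i, hd⟩, by simpa [A] using hi, inner_bvec x i⟩
    · rintro ⟨k, hk, rfl⟩
      exact ⟨k.1, by simpa [A] using hk, k.2, inner_bvec x k.1⟩
  have hβne : ((fun k => ⟪x, b k⟫) '' {k | k ∉ A}).Nonempty :=
    Set.Nonempty.image _ ⟨⟨⟨m, by omega⟩, hmd⟩, by simp [A]⟩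
  have hcα : IsCompact (insert ⟪x, v₀⟫ ((fun k => ⟪x, b k⟫) '' (A : Set κ))) :=
    ((Set.toFinite _).insert _).isCompact
  have hcβ : IsCompact ((fun k => ⟪x, b k⟫) '' {k | k ∉ A}) := (Set.toFinite _).isCompact
  have hα₁ : IsGreatest (insert ⟪x, v₀⟫ ((fun k => ⟪x, b k⟫) '' (A : Set κ))) α₁ := by
    simpa only [α₁, hαset] using hcα.isGreatest_sSup (Set.insert_nonempty _ _)
  have hα₂ : IsLeast (insert ⟪x, v₀⟫ ((fun k => ⟪x, b k⟫) '' (A : Set κ))) α₂ := by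
    simpa only [α₂, hαset] using hcα.isLeast_sInf (Set.insert_nonempty _ _)
  have hβ₁ : IsGreatest ((fun k => ⟪x, b k⟫) '' {k | k ∉ A}) β₁ := by
    simpa only [β₁, hβset] using hcβ.isGreatest_sSup hβne
  have hβ₂ : IsLeast ((fun k => ⟪x, b k⟫) '' {k | k ∉ A}) β₂ := by
    simpa only [β₂, hβset] using hcβ.isLeast_sInf hβne
  have hneg : Antitone fun r : ℝ => -r := fun r s h => neg_le_neg h
  have h1 : PhiP p a₁ a₂ P x
        = a₂ * max (spow α₁ p) (spow β₁ p)
          + (a₂ - a₁) * (-1 : ℝ) ^ (m + 1) * max (spow α₁ p) (spow β₂ p)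
          + (a₂ - a₁) * (-1 : ℝ) ^ m * spow α₁ p := by
    rw [hP, PhiP_hullWith_eq_spow hb hc hv hp0 a₁ a₂ hα₁ hβ₁ hβ₂, hcard]
  have h2 : PhiP p b₁ b₂ (-P) x
        = b₂ * max (-spow α₂ p) (-spow β₂ p)
          + (b₂ - b₁) * (-1 : ℝ) ^ (m + 1) * max (-spow α₂ p) (-spow β₁ p)
          + (b₂ - b₁) * (-1 : ℝ) ^ m * (-spow α₂ p) := by
    have hα := hneg.map_isLeast hα₂
    have hβ₁' := hneg.map_isGreatest hβ₁
    have hβ₂' := hneg.map_isLeast hβ₂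
    simp only [Set.image_insert_eq, Set.image_image, ← inner_neg_right] at hα hβ₁' hβ₂'
    have hv' : -v₀ = -∑ k ∈ A, (-v₀ k.1) • (-b) k := by
      conv_lhs => rw [hv]
      simp
    have hb' : LinearIndependent ℝ (-b) := hb.neg
    rw [hnegP, PhiP_hullWith_eq_spow hb' hc hv' hp0 b₁ b₂ hα hβ₂' hβ₁', hcard,
      spow_neg hp0.ne', spow_neg hp0.ne', spow_neg hp0.ne']
  refine ⟨h1, h2, ?_⟩
  rintro rfl rfl
  have hA : A = ∅ := Finset.card_eq_zero.1 hcard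
  have hα₁0 : α₁ = 0 := by simpa [hA] using hα₁.1
  have hα₂0 : α₂ = 0 := by simpa [hA] using hα₂.1
  have hs : spow 0 p = 0 := by simp [spow, Real.zero_rpow hp0.ne']
  rw [h1, h2, hα₁0, hα₂0, hs, neg_zero]
  constructor
  · rw [max_comm, max_comm 0 (spow β₂ p)]
    ring
  · rw [max_comm, max_comm 0 (-spow β₁ p)]
    ring
end
end
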